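/- arXiv:1011.1764 — 5 statements merged into one kernel-verified Lean document; each statement's English description precedes it below -/
import Mathlib

section
/- Assume G satisfies Hypothesis (H) with parameter ε > 0, and that μ and ν are the uniform measures on {0,1}^V and V respectively. Then every constant C such that Ent_π(f²) ≤ C·E_π(f) holds for all f : {0,1}^V × V → ℝ satisfies C ≥ ε·|V|/gap(ν); in other words, C_LS(π) ≥ ε|V|/gap(ν). -/
open Finset

/-- Flip the lamp at site `x`: `σ^x`. -/
def flipAt {V : Type*} [DecidableEq V] (σ : V → Bool) (x : V) : V → Bool :=
  Function.update σ x (!σ x)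

/-- Entropy of `h` with respect to the measure `m`:
`Ent_m(h) = Σ m·h·log(h / Σ m·h)` (the convention `0·log 0 = 0` is automatic
since `Real.log 0 = 0`). -/
noncomputable def Ent {α : Type*} [Fintype α] (m h : α → ℝ) : ℝ :=
  ∑ a, m a * h a * Real.log (h a / ∑ b, m b * h b)

/-- Variance of `g` with respect to the probability measure `m`. -/
noncomputable def Var {α : Type*} [Fintype α] (m g : α → ℝ) : ℝ :=
  ∑ a, m a * g a ^ 2 - (∑ a, m a * g a) ^ 2

/-- Base Dirichlet form `E_ν(g) = (1/2) Σ_x Σ_{y∼x} ν(x) p(x,y) (g(y)-g(x))²`. -/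
noncomputable def Enu {V : Type*} [Fintype V] (G : SimpleGraph V) [DecidableRel G.Adj]
    (p : V → V → ℝ) (ν : V → ℝ) (g : V → ℝ) : ℝ :=
  (1 / 2) * ∑ x, ∑ y ∈ G.neighborFinset x, ν x * p x y * (g y - g x) ^ 2

/-- Lamp Dirichlet form `E_μ(h) = (1/2) Σ_σ Σ_x μ(σ) c_x(σ) (h(σ^x)-h(σ))²`. -/
noncomputable def Emu {V : Type*} [Fintype V] [DecidableEq V]
    (μ : (V → Bool) → ℝ) (c : V → (V → Bool) → ℝ) (h : (V → Bool) → ℝ) : ℝ :=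
  (1 / 2) * ∑ σ : V → Bool, ∑ x : V, μ σ * c x σ * (h (flipAt σ x) - h σ) ^ 2

/-- Wreath-product Dirichlet form
`E_π(f) = (1/4) Σ_σ Σ_x π(σ,x) [Σ_{y∼x} p(x,y)(f(σ,y)-f(σ,x))² + c_x(σ)(f(σ^x,x)-f(σ,x))²]`
where `π = μ ⊗ ν`. -/
noncomputable def Epi {V : Type*} [Fintype V] [DecidableEq V]
    (G : SimpleGraph V) [DecidableRel G.Adj]
    (p : V → V → ℝ) (ν : V → ℝ) (μ : (V → Bool) → ℝ) (c : V → (V → Bool) → ℝ)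
    (f : (V → Bool) → V → ℝ) : ℝ :=
  (1 / 4) * ∑ σ : V → Bool, ∑ x : V, (μ σ * ν x) *
    ((∑ y ∈ G.neighborFinset x, p x y * (f σ y - f σ x) ^ 2)
      + c x σ * (f (flipAt σ x) x - f σ x) ^ 2)

/-- Entropy of `f²` on the wreath product with respect to `π = μ ⊗ ν`. -/
noncomputable def EntPi {V : Type*} [Fintype V] [DecidableEq V]
    (μ : (V → Bool) → ℝ) (ν : V → ℝ) (f : (V → Bool) → V → ℝ) : ℝ :=
  Ent (fun q : (V → Bool) × V => μ q.1 * ν q.2) (fun q => f q.1 q.2 ^ 2)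

/-- Closure of a set of vertices: `B̄ = {x ∈ V : ∃ y ∈ B, x ∼ y}`. -/
def closureSet {V : Type*} [Fintype V] (G : SimpleGraph V) [DecidableRel G.Adj]
    (B : Finset V) : Finset V :=
  Finset.univ.filter (fun x => ∃ y ∈ B, G.Adj x y)

lemma median_exists {V : Type*} [Fintype V] [Nonempty V] (g : V → ℝ) :
    ∃ m : ℝ, 2 * (univ.filter (fun x => m < g x)).card ≤ Fintype.card V ∧
      2 * (univ.filter (fun x => g x < m)).card ≤ Fintype.card V := by
  classical
  let T : Finset V := univ.filter (fun v =>
    2 * (univ.filter (fun x => g v < g x)).card ≤ Fintype.card V)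
  have hT : T.Nonempty := by
    obtain ⟨v, hv⟩ := Finite.exists_max g
    refine ⟨v, ?_⟩
    simp only [T, mem_filter, mem_univ, true_and]
    rw [Finset.filter_false_of_mem]
    · simp
    · intro x _
      exact not_lt.mpr (hv x)
  obtain ⟨v, hvT, hv⟩ := T.exists_min_image g hT
  refine ⟨g v, (mem_filter.mp hvT).2, ?_⟩
  by_cases hL : (univ.filter (fun x => g x < g v)).Nonempty
  · obtain ⟨w, hwL, hw⟩ := (univ.filter (fun x => g x < g v)).exists_max_image g hL
    have hwv : g w < g v := (mem_filter.mp hwL).2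
    have h1 : w ∉ T := fun h => absurd (hv w h) (not_le.mpr hwv)
    have h2 : Fintype.card V < 2 * (univ.filter (fun x => g w < g x)).card := by
      by_contra h
      exact h1 (mem_filter.mpr ⟨mem_univ _, not_lt.mp h⟩)
    have h3 : (univ.filter (fun x => g w < g x)).card + (univ.filter (fun x => g x < g v)).card
        ≤ Fintype.card V := by
      rw [← Finset.card_union_of_disjoint]
      · exact Finset.card_le_univ _
      · rw [Finset.disjoint_left]
        intro x hx hx'
        have := hw x hx'
        have h4 := (mem_filter.mp hx).2
        linarith
    omega
  · rw [Finset.not_nonempty_iff_eq_empty.mp hL]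
    simp

lemma sq_split (a b : ℝ) :
    (max a 0 - max b 0) ^ 2 + (max (-a) 0 - max (-b) 0) ^ 2 ≤ (a - b) ^ 2 := by
  rcases le_total a 0 with ha | ha <;> rcases le_total b 0 with hb | hb
  · rw [max_eq_right ha, max_eq_right hb, max_eq_left (by linarith), max_eq_left (by linarith)]
    nlinarith
  · rw [max_eq_right ha, max_eq_left hb, max_eq_left (by linarith), max_eq_right (by linarith)]
    nlinarith
  · rw [max_eq_left ha, max_eq_right hb, max_eq_right (by linarith), max_eq_left (by linarith)]
    nlinarith
  · rw [max_eq_left ha, max_eq_left hb, max_eq_right (by linarith), max_eq_right (by linarith)]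
    nlinarith

lemma mul_log_ge (h Z : ℝ) (hh : 0 ≤ h) (hZ : 0 < Z) : h - Z ≤ h * Real.log (h / Z) := by
  rcases hh.eq_or_lt with rfl | hh
  · simp; exact hZ.le
  · have := Real.one_sub_inv_le_log_of_pos (div_pos hh hZ)
    have h2 := mul_le_mul_of_nonneg_left this hh.le
    have h3 : h * (1 - (h / Z)⁻¹) = h - Z := by field_simp
    linarith

/-- Configurations that vanish wherever `g` vanishes. -/
noncomputable def lampInd {V : Type*} [Fintype V] (g : V → ℝ) (σ : V → Bool) : ℝ :=
  open Classical in if ∀ x, g x = 0 → σ x = false then 1 else 0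

lemma lampInd_sq {V : Type*} [Fintype V] (g : V → ℝ) (σ : V → Bool) :
    lampInd g σ ^ 2 = lampInd g σ := by
  unfold lampInd; split_ifs <;> simp

lemma lampInd_flip {V : Type*} [Fintype V] [DecidableEq V] (g : V → ℝ) (σ : V → Bool) (x : V)
    (hx : g x ≠ 0) : lampInd g (flipAt σ x) = lampInd g σ := by
  have : (∀ y, g y = 0 → flipAt σ x y = false) ↔ (∀ y, g y = 0 → σ y = false) := by
    refine forall_congr' fun y => ?_
    by_cases hy : y = x
    · subst hy; simp [hx]
    · simp [flipAt, hy]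
  unfold lampInd
  simp only [this]

lemma lampInd_sum {V : Type*} [Fintype V] [DecidableEq V] (g : V → ℝ) :
    ∑ σ : V → Bool, lampInd g σ * 2 ^ (univ.filter (fun x => g x = 0)).card
      = 2 ^ Fintype.card V := by
  classical
  have h1 : ∑ σ : V → Bool, lampInd g σ
      = ((Fintype.piFinset (fun x => if g x = 0 then ({false} : Finset Bool) else univ)).card : ℝ) := by
    unfold lampInd
    rw [Finset.sum_boole]
    congr 2
    ext σ
    simp only [mem_filter, mem_univ, true_and, Fintype.mem_piFinset]
    refine forall_congr' fun y => ?_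
    split_ifs with h <;> simp [h]
  rw [← Finset.sum_mul, h1, Fintype.card_piFinset]
  have h2 : ∀ x, (if g x = 0 then ({false} : Finset Bool) else univ).card
      = if g x = 0 then 1 else 2 := by
    intro x; split_ifs <;> simp
  simp only [h2]
  rw [Finset.prod_ite]
  simp only [prod_const_one, prod_const, one_mul]
  push_cast
  rw [← pow_add, add_comm, Finset.card_filter_add_card_filter_not, Finset.card_univ]

lemma key {V : Type*} [Fintype V] [DecidableEq V] [Nonempty V]
    (G : SimpleGraph V) [DecidableRel G.Adj]
    (p : V → V → ℝ) (ν : V → ℝ) (μ : (V → Bool) → ℝ) (c : V → (V → Bool) → ℝ)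
    (hνunif : ∀ x : V, ν x = 1 / (Fintype.card V : ℝ))
    (hμunif : ∀ σ : V → Bool, μ σ = 1 / 2 ^ Fintype.card V)
    (C : ℝ) (hC : ∀ f : (V → Bool) → V → ℝ, EntPi μ ν f ≤ C * Epi G p ν μ c f) (g : V → ℝ) :
    2 * (univ.filter (fun x => g x = 0)).card * Real.log 2 * (∑ x, ν x * g x ^ 2)
      ≤ C * Enu G p ν g := by
  set k := (univ.filter (fun x => g x = 0)).card with hk
  set Z := ∑ x, ν x * g x ^ 2 with hZ
  set M := ∑ σ, μ σ * lampInd g σ with hM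
  have hνpos : ∀ x, 0 < ν x := fun x => by
    rw [hνunif]; have := Fintype.card_pos (α := V); positivity
  have hνsum : ∑ x, ν x = 1 := by
    simp only [hνunif, sum_const, card_univ, nsmul_eq_mul]
    have := Fintype.card_pos (α := V)
    field_simp
  have hM2 : M * 2 ^ k = 1 := by
    have := lampInd_sum g
    rw [← hk] at this
    rw [hM]
    simp only [hμunif]
    rw [← Finset.mul_sum, mul_assoc, Finset.sum_mul, this]
    field_simp
  have hMpos : 0 < M := by
    by_contra h
    have : (0:ℝ) < 2 ^ k := by positivity
    nlinarith
  have hMinv : M = (2 ^ k)⁻¹ := eq_inv_of_mul_eq_one_left hM2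
  have hE : Epi G p ν μ c (fun σ x => g x * lampInd g σ) = M / 2 * Enu G p ν g := by
    have h0 : ∀ σ x, (μ σ * ν x) *
        ((∑ y ∈ G.neighborFinset x, p x y * (g y * lampInd g σ - g x * lampInd g σ) ^ 2)
        + c x σ * (g x * lampInd g (flipAt σ x) - g x * lampInd g σ) ^ 2)
        = (μ σ * lampInd g σ) * ∑ y ∈ G.neighborFinset x, ν x * p x y * (g y - g x) ^ 2 := by
      intro σ x
      have h1 : g x * lampInd g (flipAt σ x) - g x * lampInd g σ = 0 := by
        by_cases hx : g x = 0
        · simp [hx]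
        · rw [lampInd_flip g σ x hx]; ring
      rw [h1, Finset.mul_sum]
      simp only [ne_eq, OfNat.ofNat_ne_zero, not_false_eq_true, zero_pow, mul_zero, add_zero]
      rw [Finset.mul_sum]
      refine Finset.sum_congr rfl fun y _ => ?_
      rw [← sub_mul, mul_pow, lampInd_sq]
      ring
    unfold Epi Enu
    simp only [h0]
    simp only [← Finset.mul_sum]
    rw [← Finset.sum_mul]
    ring
  have hZnn : 0 ≤ Z := Finset.sum_nonneg fun x _ => mul_nonneg (hνpos x).le (sq_nonneg _)
  have hEnt : M * (k * Real.log 2 * Z) ≤ EntPi μ ν (fun σ x => g x * lampInd g σ) := by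
    have hsum : ∑ b : (V → Bool) × V, μ b.1 * ν b.2 * (g b.2 * lampInd g b.1) ^ 2 = M * Z := by
      rw [hM, hZ, Finset.sum_mul_sum, Fintype.sum_prod_type]
      refine Finset.sum_congr rfl fun σ _ => Finset.sum_congr rfl fun x _ => ?_
      rw [mul_pow, lampInd_sq]; ring
    unfold EntPi Ent
    simp only [hsum]
    rcases hZnn.eq_or_lt with h0 | hZpos
    · simp [← h0]
    have hpt : ∀ σ x, (μ σ * lampInd g σ) * (ν x * (g x ^ 2 - Z + g x ^ 2 * (k * Real.log 2)))
        ≤ μ σ * ν x * (g x * lampInd g σ) ^ 2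
          * Real.log ((g x * lampInd g σ) ^ 2 / (M * Z)) := by
      intro σ x
      have hμp : 0 < μ σ := by rw [hμunif]; positivity
      by_cases hs : lampInd g σ = 0
      · simp [hs]
      have hs1 : lampInd g σ = 1 := by
        unfold lampInd at hs ⊢
        split_ifs with h
        · rfl
        · simp [h] at hs
      rw [hs1]
      simp only [mul_one]
      rw [mul_assoc, mul_assoc]
      refine mul_le_mul_of_nonneg_left ?_ hμp.le
      refine mul_le_mul_of_nonneg_left ?_ (hνpos x).le
      have h1 := mul_log_ge (g x ^ 2) Z (sq_nonneg _) hZpos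
      by_cases hx : g x = 0
      · simp [hx]; exact hZpos.le
      have h2 : Real.log (g x ^ 2 / (M * Z)) = Real.log (g x ^ 2 / Z) + k * Real.log 2 := by
        have : g x ^ 2 / (M * Z) = g x ^ 2 / Z * 2 ^ k := by
          rw [hMinv]; field_simp
        rw [this, Real.log_mul (by positivity) (by positivity), Real.log_pow]
      rw [h2]
      nlinarith
    rw [Fintype.sum_prod_type]
    calc M * (k * Real.log 2 * Z)
        = ∑ σ, ∑ x, (μ σ * lampInd g σ) * (ν x * (g x ^ 2 - Z + g x ^ 2 * (k * Real.log 2))) := by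
          rw [← Finset.sum_mul_sum, ← hM]
          congr 1
          have : ∀ x, ν x * (g x ^ 2 - Z + g x ^ 2 * (k * Real.log 2))
              = ν x * g x ^ 2 - ν x * Z + ν x * g x ^ 2 * (k * Real.log 2) := fun x => by ring
          simp only [this]
          rw [Finset.sum_add_distrib, Finset.sum_sub_distrib, ← Finset.sum_mul, ← Finset.sum_mul,
            hνsum, ← hZ]
          ring
      _ ≤ _ := Finset.sum_le_sum fun σ _ => Finset.sum_le_sum fun x _ => hpt σ x
  have h := hEnt.trans (hC _)
  rw [hE] at h
  have : M * (k * Real.log 2 * Z) ≤ M * (C * Enu G p ν g / 2) := by linarith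
  have := le_of_mul_le_mul_left this hMpos
  linarith

/-- under Hypothesis (H) with parameter `ε > 0` and with `μ`, `ν`
uniform, every log-Sobolev constant `C` for `π` satisfies `C ≥ ε |V| / gap(ν)`,
i.e. `C_LS(π) ≥ ε |V| / gap(ν)`. -/
theorem lamplighter_logSobolev_lower
    {V : Type*} [Fintype V] [DecidableEq V] [Nonempty V]
    (G : SimpleGraph V) [DecidableRel G.Adj] (hconn : G.Connected)
    (p : V → V → ℝ) (ν : V → ℝ) (μ : (V → Bool) → ℝ) (c : V → (V → Bool) → ℝ)
    (hp0 : ∀ x y, 0 ≤ p x y)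
    (hpadj : ∀ x y, ¬ G.Adj x y → p x y = 0)
    (hpsum : ∀ x, ∑ y ∈ G.neighborFinset x, p x y = 1)
    (hνunif : ∀ x : V, ν x = 1 / (Fintype.card V : ℝ))
    (hrev : ∀ x y, ν x * p x y = ν y * p y x)
    (hμunif : ∀ σ : V → Bool, μ σ = 1 / 2 ^ Fintype.card V)
    (hc0 : ∀ x σ, 0 ≤ c x σ)
    (hcrev : ∀ x σ, μ σ * c x σ = μ (flipAt σ x) * c x (flipAt σ x))
    (gp : ℝ)
    (hgap : IsGreatest {C : ℝ | ∀ g : V → ℝ, C * Var ν g ≤ Enu G p ν g} gp)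
    (ε : ℝ) (hε : 0 < ε)
    (hH : ∀ B : Finset V, (Fintype.card V : ℝ) / 2 ≤ ((closureSet G B).card : ℝ) →
      ε * (Fintype.card V : ℝ) ≤ (B.card : ℝ)) :
    ∀ C : ℝ, (∀ f : (V → Bool) → V → ℝ, EntPi μ ν f ≤ C * Epi G p ν μ c f) →
      ε * (Fintype.card V : ℝ) / gp ≤ C := by
  intro C hC
  have hkey := key G p ν μ c hνunif hμunif C hC
  set n := Fintype.card V with hn
  have hnpos : 0 < n := Fintype.card_pos
  have hnR : (0:ℝ) < n := by exact_mod_cast hnpos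
  have hνpos : ∀ x, 0 < ν x := fun x => by rw [hνunif]; positivity
  have hνsum : ∑ x, ν x = 1 := by
    simp only [hνunif, sum_const, card_univ, nsmul_eq_mul]
    rw [← hn]
    field_simp
  have hnb : ∀ x, ∃ y, G.Adj x y := by
    intro x
    by_contra h
    push Not at h
    have h1 := hpsum x
    rw [Finset.sum_eq_zero] at h1
    · norm_num at h1
    · intro y hy
      exact absurd ((G.mem_neighborFinset x y).mp hy) (h y)
  have hEnn : ∀ g, 0 ≤ Enu G p ν g := fun g => by
    unfold Enu
    refine mul_nonneg (by norm_num) (Finset.sum_nonneg fun x _ => Finset.sum_nonneg fun y _ => ?_)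
    exact mul_nonneg (mul_nonneg (hνpos x).le (hp0 x y)) (sq_nonneg _)
  have hn2 : 2 ≤ n := by
    obtain ⟨v⟩ := ‹Nonempty V›
    obtain ⟨w, hw⟩ := hnb v
    have : 1 < Fintype.card V := Fintype.one_lt_card_iff.mpr ⟨v, w, hw.ne⟩
    omega
  have hlog : (0.6931471803:ℝ) < Real.log 2 := Real.log_two_gt_d9
  -- the bound on ε
  have hεle : ε ≤ Real.log 2 := by
    choose φ hφ using hnb
    obtain ⟨S, -, hS⟩ := Finset.exists_subset_card_eq (s := (univ : Finset V)) (n := (n + 1) / 2)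
      (by rw [Finset.card_univ]; omega)
    have h1 : S ⊆ closureSet G (S.image φ) := by
      intro x hx
      simp only [closureSet, mem_filter, mem_univ, true_and]
      exact ⟨φ x, mem_image_of_mem _ hx, hφ x⟩
    have h2 := Finset.card_le_card h1
    have h3 : n ≤ 2 * (closureSet G (S.image φ)).card := by omega
    have h3' : (n:ℝ) ≤ 2 * (closureSet G (S.image φ)).card := by exact_mod_cast h3
    have h4 := hH (S.image φ) (by linarith)
    have h5 : (S.image φ).card ≤ S.card := Finset.card_image_le
    have h6 : 3 * (S.image φ).card ≤ 2 * n := by omega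
    have h6' : 3 * ((S.image φ).card : ℝ) ≤ 2 * n := by exact_mod_cast h6
    have : 3 * (ε * n) ≤ 2 * n := by linarith
    have : ε ≤ 2 / 3 := by
      by_contra h
      push Not at h
      nlinarith
    linarith
  have hhalf : ∀ g : V → ℝ, n ≤ 2 * (univ.filter (fun x => g x = 0)).card →
      n * Real.log 2 * (∑ x, ν x * g x ^ 2) ≤ C * Enu G p ν g := by
    intro g hg
    refine le_trans ?_ (hkey g)
    have hg' : (n:ℝ) ≤ 2 * (univ.filter (fun x => g x = 0)).card := by exact_mod_cast hg
    have hZ : 0 ≤ ∑ x, ν x * g x ^ 2 :=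
      Finset.sum_nonneg fun x _ => mul_nonneg (hνpos x).le (sq_nonneg _)
    exact mul_le_mul_of_nonneg_right
      (mul_le_mul_of_nonneg_right hg' (by linarith)) hZ
  have hCpos : 0 < C := by
    obtain ⟨v⟩ := ‹Nonempty V›
    let g : V → ℝ := fun x => if x = v then 1 else 0
    have h0 : (univ.filter (fun x => g x = 0)) = univ.erase v := by
      ext x; simp [g]
    have h1 := hhalf g (by
      rw [h0, Finset.card_erase_of_mem (mem_univ _), Finset.card_univ]; omega)
    have h2 : ∑ x, ν x * g x ^ 2 = ν v := by simp [g]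
    rw [h2] at h1
    have h3 : 0 < n * Real.log 2 * ν v := mul_pos (mul_pos hnR (by linarith)) (hνpos v)
    by_contra h
    have := mul_nonneg (neg_nonneg.mpr (not_lt.mp h)) (hEnn g)
    linarith
  have hlam : n * Real.log 2 / C ≤ gp := by
    apply hgap.2
    intro g
    obtain ⟨m, hm1, hm2⟩ := median_exists g
    have hu := hhalf (fun x => max (g x - m) 0) (by
      have h0 : univ.filter (fun x => max (g x - m) 0 = 0) = univ.filter (fun x => ¬ m < g x) := by
        ext x; simp
      have := Finset.card_filter_add_card_filter_not (s := (univ : Finset V)) (fun x => m < g x)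
      rw [Finset.card_univ] at this
      rw [h0]; omega)
    have hw := hhalf (fun x => max (-(g x - m)) 0) (by
      have h0 : univ.filter (fun x => max (-(g x - m)) 0 = 0)
          = univ.filter (fun x => ¬ g x < m) := by
        ext x; simp
      have := Finset.card_filter_add_card_filter_not (s := (univ : Finset V)) (fun x => g x < m)
      rw [Finset.card_univ] at this
      rw [h0]; omega)
    have hEsum : Enu G p ν (fun x => max (g x - m) 0) + Enu G p ν (fun x => max (-(g x - m)) 0)
        ≤ Enu G p ν g := by
      unfold Enu
      rw [← mul_add, ← Finset.sum_add_distrib]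
      refine mul_le_mul_of_nonneg_left (Finset.sum_le_sum fun x _ => ?_) (by norm_num)
      rw [← Finset.sum_add_distrib]
      refine Finset.sum_le_sum fun y _ => ?_
      rw [← mul_add]
      refine mul_le_mul_of_nonneg_left ?_ (mul_nonneg (hνpos x).le (hp0 x y))
      have := sq_split (g y - m) (g x - m)
      have h2 : g y - m - (g x - m) = g y - g x := by ring
      rwa [h2] at this
    have hZsum : ∑ x, ν x * max (g x - m) 0 ^ 2 + ∑ x, ν x * max (-(g x - m)) 0 ^ 2
        = ∑ x, ν x * (g x - m) ^ 2 := by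
      rw [← Finset.sum_add_distrib]
      refine Finset.sum_congr rfl fun x _ => ?_
      rcases le_total (g x - m) 0 with h | h
      · rw [max_eq_right h, max_eq_left (by linarith)]; ring
      · rw [max_eq_left h, max_eq_right (by linarith)]; ring
    have hVar : Var ν g ≤ ∑ x, ν x * (g x - m) ^ 2 := by
      have h1 : ∑ x, ν x * (g x - m) ^ 2
          = ∑ x, ν x * g x ^ 2 - 2 * m * ∑ x, ν x * g x + m ^ 2 := by
        have : ∀ x, ν x * (g x - m) ^ 2
            = ν x * g x ^ 2 - 2 * m * (ν x * g x) + m ^ 2 * ν x := fun x => by ring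
        simp only [this]
        rw [Finset.sum_add_distrib, Finset.sum_sub_distrib, ← Finset.mul_sum, ← Finset.mul_sum,
          hνsum, mul_one]
      rw [h1]
      unfold Var
      nlinarith [sq_nonneg (∑ x, ν x * g x - m)]
    have hA : 0 ≤ n * Real.log 2 := mul_nonneg hnR.le (by linarith)
    have h1 := mul_le_mul_of_nonneg_left hVar hA
    have h2 := mul_le_mul_of_nonneg_left hEsum hCpos.le
    rw [← hZsum] at h1
    rw [div_mul_eq_mul_div, div_le_iff₀ hCpos]
    linarith
  have hgpos : 0 < gp := lt_of_lt_of_le (div_pos (mul_pos hnR (by linarith)) hCpos) hlam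
  rw [div_le_iff₀ hCpos] at hlam
  rw [div_le_iff₀ hgpos]
  have := mul_le_mul_of_nonneg_right hεle hnR.le
  linarith
end

section
/- Every constant C such that Ent_π(f²) ≤ C·E_π(f) holds for all f : {0,1}^V × V → ℝ satisfies C ≥ 2·max(C_LS(μ), C_LS(ν)); in other words, C_LS(π) ≥ 2 max(C_LS(μ), C_LS(ν)). (This follows by taking test functions of the form f(σ,x) = h(x) for h : V → ℝ and f(σ,x) = g(σ) for g : {0,1}^V → ℝ.) -/
open Finset

theorem EntPi_base {V : Type*} [Fintype V] [DecidableEq V]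
    (μ : (V → Bool) → ℝ) (ν : V → ℝ) (hμsum : ∑ σ : V → Bool, μ σ = 1) (g : V → ℝ) :
    EntPi μ ν (fun _ x => g x) = Ent ν (fun x => g x ^ 2) := by
  have key : ∀ F : V → ℝ, ∑ q : (V → Bool) × V, μ q.1 * F q.2 = ∑ x, F x := by
    intro F
    rw [Fintype.sum_prod_type]
    simp only [← Finset.mul_sum]
    rw [← Finset.sum_mul, hμsum, one_mul]
  unfold EntPi Ent
  have h1 : ∑ q : (V → Bool) × V, μ q.1 * ν q.2 * g q.2 ^ 2 = ∑ x, ν x * g x ^ 2 := by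
    rw [← key]
    exact Finset.sum_congr rfl fun q _ => by ring
  simp only [h1]
  refine Eq.trans ?_ (key _)
  exact Finset.sum_congr rfl fun q _ => by ring

theorem EntPi_lamp {V : Type*} [Fintype V] [DecidableEq V]
    (μ : (V → Bool) → ℝ) (ν : V → ℝ) (hνsum : ∑ x, ν x = 1) (h : (V → Bool) → ℝ) :
    EntPi μ ν (fun σ _ => h σ) = Ent μ (fun σ => h σ ^ 2) := by
  have key : ∀ F : (V → Bool) → ℝ, ∑ q : (V → Bool) × V, F q.1 * ν q.2 = ∑ σ, F σ := by
    intro F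
    rw [Fintype.sum_prod_type]
    simp only [← Finset.mul_sum, hνsum, mul_one]
  unfold EntPi Ent
  have h1 : ∑ q : (V → Bool) × V, μ q.1 * ν q.2 * h q.1 ^ 2 = ∑ σ, μ σ * h σ ^ 2 := by
    rw [← key]
    exact Finset.sum_congr rfl fun q _ => by ring
  simp only [h1]
  refine Eq.trans ?_ (key _)
  exact Finset.sum_congr rfl fun q _ => by ring

/-- `C_LS(π) ≥ 2 max(C_LS(μ), C_LS(ν))`: every log-Sobolev
constant `C` for `π` satisfies `C ≥ 2 max(C_LS(μ), C_LS(ν))`. -/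
theorem lamplighter_logSobolev_trivial_lower
    {V : Type*} [Fintype V] [DecidableEq V] [Nonempty V]
    (G : SimpleGraph V) [DecidableRel G.Adj] (hconn : G.Connected)
    (p : V → V → ℝ) (ν : V → ℝ) (μ : (V → Bool) → ℝ) (c : V → (V → Bool) → ℝ)
    (hp0 : ∀ x y, 0 ≤ p x y)
    (hpadj : ∀ x y, ¬ G.Adj x y → p x y = 0)
    (hpsum : ∀ x, ∑ y ∈ G.neighborFinset x, p x y = 1)
    (hνpos : ∀ x, 0 < ν x) (hνsum : ∑ x, ν x = 1)
    (hrev : ∀ x y, ν x * p x y = ν y * p y x)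
    (hμpos : ∀ σ, 0 < μ σ) (hμsum : ∑ σ : V → Bool, μ σ = 1)
    (hc0 : ∀ x σ, 0 ≤ c x σ)
    (hcrev : ∀ x σ, μ σ * c x σ = μ (flipAt σ x) * c x (flipAt σ x))
    (Clsμ : ℝ)
    (hClsμ : IsLeast {C : ℝ | ∀ h : (V → Bool) → ℝ,
      Ent μ (fun σ => h σ ^ 2) ≤ C * Emu μ c h} Clsμ)
    (Clsν : ℝ)
    (hClsν : IsLeast {C : ℝ | ∀ g : V → ℝ,
      Ent ν (fun x => g x ^ 2) ≤ C * Enu G p ν g} Clsν) :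
    ∀ C : ℝ, (∀ f : (V → Bool) → V → ℝ, EntPi μ ν f ≤ C * Epi G p ν μ c f) →
      2 * max Clsμ Clsν ≤ C := by
  intro C hC
  have hν1 : ∀ x, ν x ≤ 1 := fun x => by
    rw [← hνsum]
    exact Finset.single_le_sum (fun y _ => (hνpos y).le) (Finset.mem_univ x)
  -- lamp test functions
  have hlamp : ∀ h : (V → Bool) → ℝ,
      0 ≤ Epi G p ν μ c (fun σ _ => h σ) ∧
        Epi G p ν μ c (fun σ _ => h σ) ≤ Emu μ c h / 2 := by
    intro h
    have hnn : ∀ σ x, 0 ≤ μ σ * c x σ * (h (flipAt σ x) - h σ) ^ 2 := fun σ x =>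
      mul_nonneg (mul_nonneg (hμpos σ).le (hc0 x σ)) (sq_nonneg _)
    have e : Epi G p ν μ c (fun σ _ => h σ) = (1 / 4) * ∑ σ : V → Bool, ∑ x : V,
        ν x * (μ σ * c x σ * (h (flipAt σ x) - h σ) ^ 2) := by
      unfold Epi
      congr 1
      refine Finset.sum_congr rfl fun σ _ => Finset.sum_congr rfl fun x _ => ?_
      simp
      ring
    rw [e]
    constructor
    · exact mul_nonneg (by norm_num) (Finset.sum_nonneg fun σ _ => Finset.sum_nonneg fun x _ =>
        mul_nonneg (hνpos x).le (hnn σ x))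
    · have : ∑ σ : V → Bool, ∑ x : V, ν x * (μ σ * c x σ * (h (flipAt σ x) - h σ) ^ 2)
          ≤ ∑ σ : V → Bool, ∑ x : V, μ σ * c x σ * (h (flipAt σ x) - h σ) ^ 2 :=
        Finset.sum_le_sum fun σ _ => Finset.sum_le_sum fun x _ =>
          mul_le_of_le_one_left (hnn σ x) (hν1 x)
      unfold Emu
      linarith
  have hbase : ∀ g : V → ℝ, Epi G p ν μ c (fun _ x => g x) = Enu G p ν g / 2 := by
    intro g
    have e : Epi G p ν μ c (fun _ x => g x) = (1 / 4) * ∑ σ : V → Bool, μ σ *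
        ∑ x, ∑ y ∈ G.neighborFinset x, ν x * p x y * (g y - g x) ^ 2 := by
      unfold Epi
      congr 1
      refine Finset.sum_congr rfl fun σ _ => ?_
      rw [Finset.mul_sum]
      refine Finset.sum_congr rfl fun x _ => ?_
      simp only [sub_self, ne_eq, OfNat.ofNat_ne_zero, not_false_eq_true, zero_pow, mul_zero,
        add_zero, mul_assoc, ← Finset.mul_sum]
    rw [e, ← Finset.sum_mul, hμsum]
    unfold Enu
    ring
  -- positivity of `C`
  have hCpos : 0 ≤ C := by
    let σ₀ : V → Bool := fun _ => false
    let σ₁ : V → Bool := fun _ => true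
    have hne : σ₀ ≠ σ₁ := fun h => by
      have := congrFun h (Classical.arbitrary V)
      simp [σ₀, σ₁] at this
    have hlt : μ σ₀ < 1 := by
      have : ∑ σ ∈ {σ₀, σ₁}, μ σ ≤ ∑ σ, μ σ :=
        Finset.sum_le_sum_of_subset_of_nonneg (Finset.subset_univ _) fun σ _ _ => (hμpos σ).le
      rw [Finset.sum_pair hne, hμsum] at this
      linarith [hμpos σ₁]
    have h1 := hC (fun σ _ => if σ = σ₀ then 1 else 0)
    rw [EntPi_lamp μ ν hνsum (fun σ => if σ = σ₀ then 1 else 0)] at h1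
    have h2 := (hlamp (fun σ => if σ = σ₀ then 1 else 0)).1
    have h3 : Ent μ (fun σ => (if σ = σ₀ then (1:ℝ) else 0) ^ 2)
        = μ σ₀ * Real.log (1 / μ σ₀) := by
      unfold Ent
      simp [ite_pow]
    rw [h3] at h1
    have h4 : 0 < μ σ₀ * Real.log (1 / μ σ₀) :=
      mul_pos (hμpos _) (Real.log_pos (by rw [lt_div_iff₀ (hμpos _)]; linarith))
    by_contra hneg
    push Not at hneg
    have := mul_nonpos_of_nonpos_of_nonneg hneg.le h2
    linarith
  have hA : Clsμ ≤ C / 2 := hClsμ.2 fun h => by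
    rw [← EntPi_lamp μ ν hνsum h]
    refine (hC _).trans ?_
    have := mul_le_mul_of_nonneg_left (hlamp h).2 hCpos
    linarith
  have hB : Clsν ≤ C / 2 := hClsν.2 fun g => by
    rw [← EntPi_base μ ν hμsum g]
    refine (hC _).trans ?_
    rw [hbase]
    linarith
  have := max_le hA hB
  linarith
end

section
/- Let A ⊆ V and let g : V → ℝ be a function whose support is disjoint from A ∪ Ā and with E_ν(g) > 0. Then every constant C such that Ent_π(f²) ≤ C·E_π(f) holds for all f : {0,1}^V × V → ℝ satisfies C ≥ 2·(ν(g²)/E_ν(g))·log(1/μ({σ : σ(y)=1 for all y ∈ A})); in particular this is obtained from the test function f(σ,x) = g(x)·1_{σ ≡ 1 on A}(σ). -/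
open Finset

/-- if `g : V → ℝ` vanishes on `A ∪ Ā` and `E_ν(g) > 0`, then every
log-Sobolev constant `C` for `π` satisfies
`C ≥ 2 (ν(g²)/E_ν(g)) log(1/μ({σ : σ ≡ 1 on A}))` (via the test function
`f(σ,x) = g(x)·1_{σ_A ≡ 1}(σ)`). -/
theorem lamplighter_test_function_lower_bound
    {V : Type*} [Fintype V] [DecidableEq V] [Nonempty V]
    (G : SimpleGraph V) [DecidableRel G.Adj] (hconn : G.Connected)
    (p : V → V → ℝ) (ν : V → ℝ) (μ : (V → Bool) → ℝ) (c : V → (V → Bool) → ℝ)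
    (hp0 : ∀ x y, 0 ≤ p x y)
    (hpadj : ∀ x y, ¬ G.Adj x y → p x y = 0)
    (hpsum : ∀ x, ∑ y ∈ G.neighborFinset x, p x y = 1)
    (hνpos : ∀ x, 0 < ν x) (hνsum : ∑ x, ν x = 1)
    (hrev : ∀ x y, ν x * p x y = ν y * p y x)
    (hμpos : ∀ σ, 0 < μ σ) (hμsum : ∑ σ : V → Bool, μ σ = 1)
    (hc0 : ∀ x σ, 0 ≤ c x σ)
    (hcrev : ∀ x σ, μ σ * c x σ = μ (flipAt σ x) * c x (flipAt σ x))
    (A : Finset V) (g : V → ℝ)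
    (hsupp : ∀ x, x ∈ A ∪ closureSet G A → g x = 0)
    (hEg : 0 < Enu G p ν g) :
    ∀ C : ℝ, (∀ f : (V → Bool) → V → ℝ, EntPi μ ν f ≤ C * Epi G p ν μ c f) →
      2 * ((∑ x, ν x * g x ^ 2) / Enu G p ν g) *
          Real.log (1 / ∑ σ ∈ Finset.univ.filter
            (fun σ : V → Bool => ∀ y ∈ A, σ y = true), μ σ) ≤ C := by
  intro C hC
  set S := Finset.univ.filter (fun σ : V → Bool => ∀ y ∈ A, σ y = true) with hS
  set m := ∑ σ ∈ S, μ σ with hm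
  set s := ∑ x, ν x * g x ^ 2 with hs
  have hmpos : 0 < m := by
    apply Finset.sum_pos (fun σ _ => hμpos σ)
    exact ⟨fun _ => true, by simp [hS]⟩
  have hspos : 0 < s := by
    by_contra hcon
    have h0 : ∀ x, 0 ≤ ν x * g x ^ 2 := fun x => mul_nonneg (hνpos x).le (sq_nonneg _)
    have hs0 : s = 0 := le_antisymm (not_lt.mp hcon) (Finset.sum_nonneg fun x _ => h0 x)
    have hg : ∀ x, g x = 0 := by
      intro x
      have := (Finset.sum_eq_zero_iff_of_nonneg (fun x _ => h0 x)).1 hs0 x (Finset.mem_univ x)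
      have h2 := (hνpos x).ne'
      simpa [h2] using this
    simp [Enu, hg] at hEg
  let I : (V → Bool) → ℝ := fun σ => if ∀ y ∈ A, σ y = true then 1 else 0
  have hI2 : ∀ σ, I σ ^ 2 = I σ := by
    intro σ
    by_cases h : ∀ y ∈ A, σ y = true <;> simp [I, h]
  have hIm : ∑ σ, μ σ * I σ = m := by
    simp [hm, hS, I, Finset.sum_filter]
  have hflip : ∀ σ x, I (flipAt σ x) * g x - I σ * g x = 0 := by
    intro σ x
    by_cases hx : x ∈ A
    · rw [hsupp x (Finset.mem_union_left _ hx)]; simp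
    · have : I (flipAt σ x) = I σ := by
        have : (∀ y ∈ A, flipAt σ x y = true) ↔ (∀ y ∈ A, σ y = true) := by
          refine forall₂_congr fun y hy => ?_
          have : y ≠ x := fun h => hx (h ▸ hy)
          simp [flipAt, Function.update_of_ne this]
        simp only [I, this]
      rw [this, sub_self]
  have hEpi : Epi G p ν μ c (fun σ x => I σ * g x) = m * Enu G p ν g / 2 := by
    have : ∀ σ x, (μ σ * ν x) *
        ((∑ y ∈ G.neighborFinset x, p x y * (I σ * g y - I σ * g x) ^ 2)
          + c x σ * (I (flipAt σ x) * g x - I σ * g x) ^ 2)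
        = (μ σ * I σ) * ∑ y ∈ G.neighborFinset x, ν x * p x y * (g y - g x) ^ 2 := by
      intro σ x
      rw [hflip, Finset.mul_sum, ← hI2 σ]
      simp only [ne_eq, OfNat.ofNat_ne_zero, not_false_eq_true, zero_pow, mul_zero, add_zero]
      rw [Finset.mul_sum]
      refine Finset.sum_congr rfl fun y _ => ?_
      rw [hI2 σ, ← mul_sub, mul_pow, hI2 σ]; ring
    simp only [Epi, this]
    simp only [← Finset.mul_sum]
    rw [← Finset.sum_mul, hIm, Enu]; ring
  have hmass : ∑ q : (V → Bool) × V, μ q.1 * ν q.2 * (I q.1 * g q.2) ^ 2 = m * s := by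
    rw [Fintype.sum_prod_type, ← hIm, hs, Finset.sum_mul_sum]
    refine Finset.sum_congr rfl fun σ _ => Finset.sum_congr rfl fun x _ => ?_
    simp only [mul_pow, hI2]; ring
  have hEnt : m * s * Real.log (1 / m) ≤ EntPi μ ν (fun σ x => I σ * g x) := by
    have hterm : ∀ σ x, (μ σ * I σ) * (ν x * g x ^ 2 * Real.log (1 / m) + ν x * g x ^ 2 - ν x * s)
        ≤ μ σ * ν x * (I σ * g x) ^ 2 * Real.log ((I σ * g x) ^ 2 / (m * s)) := by
      intro σ x
      by_cases h : ∀ y ∈ A, σ y = true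
      · have hI : I σ = 1 := if_pos h
        rw [hI]
        simp only [one_mul, mul_one]
        have key : g x ^ 2 * Real.log (1 / m) + g x ^ 2 - s
            ≤ g x ^ 2 * Real.log (g x ^ 2 / (m * s)) := by
          by_cases hg : g x = 0
          · simp [hg, hspos.le]
          · have hg2 : 0 < g x ^ 2 := by positivity
            have e : g x ^ 2 / (m * s) = (1 / m) * (s / g x ^ 2)⁻¹ := by
              field_simp
            have hl := Real.log_le_sub_one_of_pos (div_pos hspos hg2)
            rw [e, Real.log_mul (by positivity) (by positivity), Real.log_inv]
            have := mul_le_mul_of_nonneg_left hl hg2.le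
            have e2 : g x ^ 2 * (s / g x ^ 2 - 1) = s - g x ^ 2 := by field_simp
            linarith
        have := mul_le_mul_of_nonneg_left key (mul_pos (hμpos σ) (hνpos x)).le
        linarith
      · have hI : I σ = 0 := if_neg h
        rw [hI]; simp
    rw [EntPi, Ent, hmass, Fintype.sum_prod_type]
    refine le_trans (le_of_eq ?_)
      (Finset.sum_le_sum fun σ _ => Finset.sum_le_sum fun x _ => hterm σ x)
    simp only [← Finset.mul_sum]
    rw [← Finset.sum_mul, hIm, Finset.sum_sub_distrib, Finset.sum_add_distrib,
      ← Finset.sum_mul, ← Finset.sum_mul, hνsum, ← hs]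
    ring
  have h := hEnt.trans (hC _)
  rw [hEpi] at h
  have h2 : 2 * s * Real.log (1 / m) ≤ C * Enu G p ν g := by
    have : m * (2 * s * Real.log (1 / m)) ≤ m * (C * Enu G p ν g) := by linarith
    exact le_of_mul_le_mul_left this hmpos
  calc 2 * (s / Enu G p ν g) * Real.log (1 / m)
      = (2 * s * Real.log (1 / m)) / Enu G p ν g := by ring
    _ ≤ C := (div_le_iff₀ hEg).2 h2
end

section
/- Fix d ≥ 1. There exist constants c, C > 0 depending only on d such that for all n ≥ 2 the following holds. Let G be the d-dimensional discrete torus ℤ_n^d with nearest-neighbor adjacency, let the lamplighter perform simple random walk (p(x,y) = 1/(2d) for y ∼ x), let ν be the uniform measure on ℤ_n^d, let μ be the uniform measure on {0,1}^{ℤ_n^d}, and let c_x(σ) = 1/2 for all x, σ. Then the logarithmic Sobolev constant of the lamplighter graph satisfies c·n^{d+2} ≤ C_LS(π) ≤ C·n^{d+2}. -/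
open Finset

theorem ent_prod {α β : Type*} [Fintype α] [Fintype β] (m1 : α → ℝ) (m2 : β → ℝ)
    (h1 : ∀ a, 0 ≤ m1 a) (h2 : ∀ b, 0 ≤ m2 b) (F : α × β → ℝ) (hF : ∀ q, 0 ≤ F q) :
    Ent (fun q : α × β => m1 q.1 * m2 q.2) F =
      ∑ b, m2 b * Ent m1 (fun a => F (a, b)) + Ent m2 (fun b => ∑ a, m1 a * F (a, b)) := by
  have hT : ∑ q : α × β, m1 q.1 * m2 q.2 * F q = ∑ b, m2 b * ∑ a, m1 a * F (a, b) := by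
    rw [Fintype.sum_prod_type_right]
    refine Finset.sum_congr rfl fun b _ => ?_
    rw [Finset.mul_sum]
    refine Finset.sum_congr rfl fun a _ => ?_
    ring
  unfold Ent
  rw [hT, Fintype.sum_prod_type_right, ← Finset.sum_add_distrib]
  refine Finset.sum_congr rfl fun b _ => ?_
  simp only
  rw [Finset.mul_sum (a := m2 b), Finset.mul_sum (a := m2 b), Finset.sum_mul,
    ← Finset.sum_add_distrib]
  refine Finset.sum_congr rfl fun a _ => ?_
  by_cases hz : m2 b * (m1 a * F (a, b)) = 0
  · have e1 : m1 a * m2 b * F (a, b) = 0 := by rw [← hz]; ring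
    rw [hz, e1]
    rw [← mul_assoc, hz]; ring
  have hb : 0 < m2 b := lt_of_le_of_ne (h2 b) (fun h => hz (by rw [← h]; ring))
  have ha : 0 < m1 a := lt_of_le_of_ne (h1 a) (fun h => hz (by rw [← h]; ring))
  have hf : 0 < F (a, b) := lt_of_le_of_ne (hF _) (fun h => hz (by rw [← h]; ring))
  have hS : 0 < ∑ a, m1 a * F (a, b) :=
    Finset.sum_pos' (fun a _ => mul_nonneg (h1 a) (hF _)) ⟨a, Finset.mem_univ _, mul_pos ha hf⟩
  have hT' : 0 < ∑ b, m2 b * ∑ a, m1 a * F (a, b) :=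
    Finset.sum_pos' (fun b _ => mul_nonneg (h2 b)
      (Finset.sum_nonneg fun a _ => mul_nonneg (h1 a) (hF _))) ⟨b, Finset.mem_univ _, mul_pos hb hS⟩
  rw [Real.log_div hf.ne' hT'.ne', Real.log_div hf.ne' hS.ne', Real.log_div hS.ne' hT'.ne']
  ring

theorem weak_lsi {β : Type*} [Fintype β] [Nonempty β] (g : β → ℝ) :
    Ent (fun _ : β => 1 / (Fintype.card β : ℝ)) (fun b => g b ^ 2) ≤
      1 / (Fintype.card β : ℝ) * ∑ b, ∑ b', (g b - g b') ^ 2 := by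
  have hN : (0 : ℝ) < Fintype.card β := by exact_mod_cast Fintype.card_pos
  set N : ℝ := (Fintype.card β : ℝ) with hNdef
  unfold Ent
  set T : ℝ := ∑ b, 1 / N * g b ^ 2 with hT
  have hT0 : 0 ≤ T := Finset.sum_nonneg fun b _ => by positivity
  have hNT : N * T = ∑ b, g b ^ 2 := by
    rw [hT, ← Finset.mul_sum]; field_simp
  clear_value T
  rcases hT0.eq_or_lt with h0 | hpos
  · rw [← h0]
    simp only [div_zero, Real.log_zero, mul_zero, Finset.sum_const_zero]
    exact mul_nonneg (by positivity) (Finset.sum_nonneg fun b _ => Finset.sum_nonneg fun b' _ => sq_nonneg _)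
  have step1 : ∑ b, 1 / N * g b ^ 2 * Real.log (g b ^ 2 / T) ≤
      ∑ b, 1 / N * g b ^ 2 * (g b ^ 2 / T - 1) := by
    refine Finset.sum_le_sum fun b _ => ?_
    rcases (sq_nonneg (g b)).eq_or_lt with hb | hb
    · rw [← hb]; simp
    · exact mul_le_mul_of_nonneg_left (Real.log_le_sub_one_of_pos (by positivity)) (by positivity)
  have step2 : ∑ b, 1 / N * g b ^ 2 * (g b ^ 2 / T - 1) =
      1 / (2 * N ^ 2 * T) * ∑ b, ∑ b', (g b ^ 2 - g b' ^ 2) ^ 2 := by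
    have e1 : ∑ b, ∑ b', (g b ^ 2 - g b' ^ 2) ^ 2 =
        2 * N * ∑ b, (g b ^ 2) ^ 2 - 2 * (∑ b, g b ^ 2) ^ 2 := by
      have : ∀ b b', (g b ^ 2 - g b' ^ 2) ^ 2 = (g b ^ 2) ^ 2 + (g b' ^ 2) ^ 2 - 2 * (g b ^ 2 * g b' ^ 2) := by
        intros; ring
      simp only [this, Finset.sum_sub_distrib, Finset.sum_add_distrib, ← Finset.mul_sum,
        ← Finset.sum_mul, Finset.sum_const, Finset.card_univ, nsmul_eq_mul]
      rw [← hNdef]; ring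
    have e2 : ∑ b, 1 / N * g b ^ 2 * (g b ^ 2 / T - 1) =
        1 / (N * T) * ∑ b, (g b ^ 2) ^ 2 - 1 / N * ∑ b, g b ^ 2 := by
      rw [Finset.mul_sum, Finset.mul_sum, ← Finset.sum_sub_distrib]
      refine Finset.sum_congr rfl fun b _ => ?_
      field_simp
    rw [e1, e2, ← hNT]
    field_simp
  have step3 : ∑ b, ∑ b', (g b ^ 2 - g b' ^ 2) ^ 2 ≤ ∑ b, ∑ b', (2 * (N * T)) * (g b - g b') ^ 2 := by
    classical
    refine Finset.sum_le_sum fun b _ => Finset.sum_le_sum fun b' _ => ?_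
    by_cases hbb : b = b'
    · subst hbb; simp
    have h2 : g b ^ 2 + g b' ^ 2 ≤ N * T := by
      rw [hNT, ← Finset.sum_pair (f := fun b => g b ^ 2) hbb]
      exact Finset.sum_le_sum_of_subset_of_nonneg (Finset.subset_univ _) fun _ _ _ => sq_nonneg _
    have e : (g b ^ 2 - g b' ^ 2) ^ 2 = (g b + g b') ^ 2 * (g b - g b') ^ 2 := by ring
    rw [e]
    refine mul_le_mul_of_nonneg_right ?_ (sq_nonneg _)
    nlinarith [sq_nonneg (g b - g b')]
  refine step1.trans (step2.le.trans ?_)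
  calc _ ≤ 1 / (2 * N ^ 2 * T) * ∑ b, ∑ b', (2 * (N * T)) * (g b - g b') ^ 2 :=
        mul_le_mul_of_nonneg_left step3 (by positivity)
    _ = _ := by
        simp only [← Finset.mul_sum]
        field_simp

theorem sqrt_diff {α : Type*} [Fintype α] (m u v : α → ℝ) (hm : ∀ a, 0 ≤ m a) :
    (Real.sqrt (∑ a, m a * u a ^ 2) - Real.sqrt (∑ a, m a * v a ^ 2)) ^ 2 ≤
      ∑ a, m a * (u a - v a) ^ 2 := by
  have hU : 0 ≤ ∑ a, m a * u a ^ 2 := Finset.sum_nonneg fun a _ => mul_nonneg (hm a) (sq_nonneg _)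
  have hV : 0 ≤ ∑ a, m a * v a ^ 2 := Finset.sum_nonneg fun a _ => mul_nonneg (hm a) (sq_nonneg _)
  have cs : ∑ a, m a * (u a * v a) ≤
      Real.sqrt (∑ a, m a * u a ^ 2) * Real.sqrt (∑ a, m a * v a ^ 2) := by
    have := Real.sum_mul_le_sqrt_mul_sqrt Finset.univ (fun a => Real.sqrt (m a) * u a)
      (fun a => Real.sqrt (m a) * v a)
    have e : ∀ (s t : ℝ) a, Real.sqrt (m a) * s * (Real.sqrt (m a) * t) = m a * (s * t) := by
      intro s t a
      have := Real.mul_self_sqrt (hm a)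
      calc _ = (Real.sqrt (m a) * Real.sqrt (m a)) * (s * t) := by ring
        _ = _ := by rw [this]
    simp only [mul_pow, Real.sq_sqrt (hm _), e] at this
    exact this
  have e : ∑ a, m a * (u a - v a) ^ 2 =
      ∑ a, m a * u a ^ 2 + ∑ a, m a * v a ^ 2 - 2 * ∑ a, m a * (u a * v a) := by
    rw [Finset.mul_sum, ← Finset.sum_add_distrib, ← Finset.sum_sub_distrib]
    refine Finset.sum_congr rfl fun a _ => ?_
    ring
  rw [e, sub_sq, Real.sq_sqrt hU, Real.sq_sqrt hV]
  nlinarith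

theorem prod_lsi {α β : Type*} [Fintype α] [Fintype β] [Nonempty β] (m1 : α → ℝ)
    (h1 : ∀ a, 0 ≤ m1 a) (Q : (α → ℝ) → ℝ)
    (hQ : ∀ g : α → ℝ, Ent m1 (fun a => g a ^ 2) ≤ Q g) (f : α → β → ℝ) :
    Ent (fun q : α × β => m1 q.1 * (1 / (Fintype.card β : ℝ))) (fun q => f q.1 q.2 ^ 2) ≤
      ∑ b, (1 / (Fintype.card β : ℝ)) * Q (fun a => f a b) +
      ∑ a, m1 a * (1 / (Fintype.card β : ℝ) * ∑ b, ∑ b', (f a b - f a b') ^ 2) := by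
  have key := ent_prod m1 (fun _ : β => 1 / (Fintype.card β : ℝ)) h1 (fun _ => by positivity)
    (fun q => f q.1 q.2 ^ 2) (fun _ => sq_nonneg _)
  rw [key]
  refine add_le_add (Finset.sum_le_sum fun b _ => mul_le_mul_of_nonneg_left (hQ _) (by positivity)) ?_
  have hpos : ∀ b, 0 ≤ ∑ a, m1 a * f a b ^ 2 :=
    fun b => Finset.sum_nonneg fun a _ => mul_nonneg (h1 a) (sq_nonneg _)
  have := weak_lsi (fun b => Real.sqrt (∑ a, m1 a * f a b ^ 2))
  simp only [Real.sq_sqrt (hpos _)] at this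
  refine this.trans ?_
  calc _ ≤ 1 / (Fintype.card β : ℝ) * ∑ b, ∑ b', ∑ a, m1 a * (f a b - f a b') ^ 2 := by
        refine mul_le_mul_of_nonneg_left ?_ (by positivity)
        exact Finset.sum_le_sum fun b _ => Finset.sum_le_sum fun b' _ => sqrt_diff _ _ _ h1
    _ = _ := by
        have : ∀ b, ∑ b', ∑ a, m1 a * (f a b - f a b') ^ 2 = ∑ a, m1 a * ∑ b', (f a b - f a b') ^ 2 := by
          intro b
          rw [Finset.sum_comm]
          simp only [Finset.mul_sum]
        simp only [this]
        rw [Finset.sum_comm, Finset.mul_sum]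
        refine Finset.sum_congr rfl fun a _ => ?_
        rw [← Finset.mul_sum]; ring

theorem ent_equiv {α β : Type*} [Fintype α] [Fintype β] (e : α ≃ β) (m h : β → ℝ) :
    Ent m h = Ent (fun a => m (e a)) (fun a => h (e a)) := by
  unfold Ent
  rw [← Equiv.sum_comp e (fun b => m b * h b), ← Equiv.sum_comp e]

theorem lamp_lsi_fin (N : ℕ) (f : (Fin N → Bool) → ℝ) :
    Ent (fun _ : Fin N → Bool => 1 / (2 : ℝ) ^ N) (fun σ => f σ ^ 2) ≤
      ∑ σ, 1 / (2 : ℝ) ^ N * ∑ z, (f (flipAt σ z) - f σ) ^ 2 := by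
  induction N with
  | zero => simp [Ent]
  | succ N ih =>
    let e : (Fin N → Bool) × Bool ≃ (Fin (N + 1) → Bool) :=
      (Equiv.prodComm _ _).trans (Fin.consEquiv (fun _ => Bool))
    have he : ∀ τ b, e (τ, b) = Fin.cons b τ := fun τ b => rfl
    rw [ent_equiv e, ← Equiv.sum_comp e]
    have := prod_lsi (β := Bool) (fun _ : Fin N → Bool => 1 / (2 : ℝ) ^ N)
      (fun _ => by positivity) _ ih (fun τ b => f (e (τ, b)))
    have hm : ∀ q : (Fin N → Bool) × Bool, (1 : ℝ) / 2 ^ (N + 1) = 1 / 2 ^ N * (1 / (Fintype.card Bool : ℝ)) := by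
      intro _; rw [Fintype.card_bool, pow_succ]; push_cast; field_simp
    rw [← funext hm] at this
    refine this.trans (le_of_eq ?_)
    rw [Fintype.sum_prod_type_right]
    have f0 : ∀ τ b, flipAt (Fin.cons b τ : Fin (N + 1) → Bool) 0 = Fin.cons (!b) τ := by
      intro τ b; simp [flipAt]
    have f1 : ∀ τ b (z : Fin N), flipAt (Fin.cons b τ : Fin (N + 1) → Bool) z.succ = Fin.cons b (flipAt τ z) := by
      intro τ b z; simp [flipAt, Fin.cons_update]
    simp only [he, Fin.sum_univ_succ, f0, f1, Fintype.sum_bool, Fintype.card_bool, Finset.mul_sum,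
      mul_add, Finset.sum_add_distrib, Bool.not_true, Bool.not_false, sub_self]
    simp only [← Finset.mul_sum, pow_succ (2 : ℝ) N]
    simp only [ne_eq, OfNat.ofNat_ne_zero, not_false_eq_true, zero_pow, Finset.sum_const_zero, mul_zero]
    push_cast
    have sw : ∑ τ : Fin N → Bool, (f (Fin.cons true τ) - f (Fin.cons false τ)) ^ 2 =
      ∑ τ : Fin N → Bool, (f (Fin.cons false τ) - f (Fin.cons true τ)) ^ 2 :=
      Finset.sum_congr rfl fun _ _ => by ring
    rw [sw]
    field_simp
    ring

theorem lamp_lsi {V : Type*} [Fintype V] [DecidableEq V] (f : (V → Bool) → ℝ) :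
    Ent (fun _ : V → Bool => 1 / (2 : ℝ) ^ (Fintype.card V)) (fun σ => f σ ^ 2) ≤
      ∑ σ, 1 / (2 : ℝ) ^ (Fintype.card V) * ∑ z, (f (flipAt σ z) - f σ) ^ 2 := by
  let e := Fintype.equivFin V
  let E : (Fin (Fintype.card V) → Bool) ≃ (V → Bool) := Equiv.arrowCongr e.symm (Equiv.refl _)
  have hE : ∀ σ v, E σ v = σ (e v) := fun _ _ => rfl
  rw [ent_equiv E, ← Equiv.sum_comp E]
  refine (lamp_lsi_fin _ (fun σ => f (E σ))).trans (le_of_eq ?_)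
  refine Finset.sum_congr rfl fun σ _ => ?_
  rw [← Equiv.sum_comp e]
  congr 1
  refine Finset.sum_congr rfl fun z _ => ?_
  have : E (flipAt σ (e z)) = flipAt (E σ) z := by
    funext v
    simp only [hE, flipAt, Function.update_apply, e.injective.eq_iff]
  rw [this]

noncomputable def shiftNrm {V : Type*} [Fintype V] [AddCommGroup V] (g : V → ℝ) (h : V) : ℝ :=
  ∑ x, (g (x + h) - g x) ^ 2

theorem shiftNrm_nonneg {V : Type*} [Fintype V] [AddCommGroup V] (g : V → ℝ) (h : V) :
    0 ≤ shiftNrm g h := Finset.sum_nonneg fun _ _ => sq_nonneg _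

theorem shiftNrm_add {V : Type*} [Fintype V] [AddCommGroup V] (g : V → ℝ) (a b : V)
    (t : ℝ) (ht : 0 < t) :
    shiftNrm g (a + b) ≤ (1 + t) * shiftNrm g a + (1 + 1 / t) * shiftNrm g b := by
  have e : shiftNrm g a = ∑ x, (g (x + b + a) - g (x + b)) ^ 2 := by
    unfold shiftNrm
    exact (Equiv.sum_comp (Equiv.addRight b) (fun x => (g (x + a) - g x) ^ 2)).symm
  rw [e]
  unfold shiftNrm
  rw [Finset.mul_sum, Finset.mul_sum, ← Finset.sum_add_distrib]
  refine Finset.sum_le_sum fun x _ => ?_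
  have e2 : x + (a + b) = x + b + a := by abel
  rw [e2]
  set p := g (x + b + a) - g (x + b)
  set q := g (x + b) - g x
  have : g (x + b + a) - g x = p + q := by simp [p, q]
  rw [this]
  have h : (1 + t) * p ^ 2 + (1 + 1 / t) * q ^ 2 - (p + q) ^ 2 = (t * p - q) ^ 2 / t := by
    field_simp; ring
  have : 0 ≤ (t * p - q) ^ 2 / t := by positivity
  linarith

theorem shiftNrm_sum {V ι : Type*} [Fintype V] [AddCommGroup V] (g : V → ℝ) (h : ι → V)
    (s : Finset ι) :
    shiftNrm g (∑ i ∈ s, h i) ≤ (s.card : ℝ) * ∑ i ∈ s, shiftNrm g (h i) := by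
  classical
  induction s using Finset.induction_on with
  | empty => simp [shiftNrm]
  | insert i s hi ih =>
    rw [Finset.sum_insert hi, Finset.sum_insert hi, Finset.card_insert_of_notMem hi]
    rcases s.eq_empty_or_nonempty with rfl | hs
    · simp
    have hc : (0 : ℝ) < s.card := by exact_mod_cast hs.card_pos
    refine (shiftNrm_add g _ _ (s.card : ℝ) hc).trans ?_
    have : (1 + 1 / (s.card : ℝ)) * shiftNrm g (∑ i ∈ s, h i) ≤
        (1 + 1 / (s.card : ℝ)) * ((s.card : ℝ) * ∑ i ∈ s, shiftNrm g (h i)) :=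
      mul_le_mul_of_nonneg_left ih (by positivity)
    have e : (1 + 1 / (s.card : ℝ)) * ((s.card : ℝ) * ∑ i ∈ s, shiftNrm g (h i)) =
      (s.card + 1) * ∑ i ∈ s, shiftNrm g (h i) := by field_simp
    push_cast
    linarith

theorem shiftNrm_nsmul {V : Type*} [Fintype V] [AddCommGroup V] (g : V → ℝ) (h : V) (k : ℕ) :
    shiftNrm g (k • h) ≤ (k : ℝ) ^ 2 * shiftNrm g h := by
  have := shiftNrm_sum g (fun _ : ℕ => h) (Finset.range k)
  simp only [Finset.sum_const, Finset.card_range, nsmul_eq_mul] at this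
  rw [← nsmul_eq_mul] at this
  simpa [pow_two, mul_assoc] using this

theorem torus_poincare (d n : ℕ) [NeZero n] (g : (Fin d → ZMod n) → ℝ) :
    ∑ x, ∑ y, (g x - g y) ^ 2 ≤
      (n : ℝ) ^ d * (d * (n : ℝ) ^ 2 * ∑ x, ∑ i, (g (x + Pi.single i 1) - g x) ^ 2) := by
  have e1 : ∑ x, ∑ y, (g x - g y) ^ 2 = ∑ h, shiftNrm g h := by
    rw [Finset.sum_comm]
    unfold shiftNrm
    rw [Finset.sum_comm (γ := Fin d → ZMod n) (s := Finset.univ) (t := Finset.univ)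
      (f := fun h x => (g (x + h) - g x) ^ 2)]
    refine Finset.sum_congr rfl fun y _ => ?_
    exact (Equiv.sum_comp (Equiv.addLeft y) (fun x => (g x - g y) ^ 2)).symm
  have e2 : ∀ h, shiftNrm g h ≤ d * (n : ℝ) ^ 2 * ∑ x, ∑ i, (g (x + Pi.single i 1) - g x) ^ 2 := by
    intro h
    have hh : h = ∑ i : Fin d, (h i).val • (Pi.single i 1 : Fin d → ZMod n) := by
      funext j
      have hj : ∀ i : Fin d, ((h i).val • (Pi.single i 1 : Fin d → ZMod n)) j = if j = i then h i else 0 := by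
        intro i
        rw [Pi.smul_apply, Pi.single_apply, nsmul_eq_mul, ZMod.natCast_zmod_val]
        simp
      rw [Finset.sum_apply, Finset.sum_congr rfl fun i _ => hj i]
      simp
    have h1 := shiftNrm_sum g (fun i : Fin d => (h i).val • (Pi.single i 1 : Fin d → ZMod n)) Finset.univ
    rw [← hh] at h1
    refine h1.trans ?_
    rw [Finset.card_univ, Fintype.card_fin, mul_assoc]
    refine mul_le_mul_of_nonneg_left ?_ (by positivity)
    rw [Finset.sum_comm, Finset.mul_sum]
    refine Finset.sum_le_sum fun i _ => ?_
    refine (shiftNrm_nsmul g _ _).trans ?_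
    refine mul_le_mul_of_nonneg_right ?_ (shiftNrm_nonneg _ _)
    have : ((h i).val : ℝ) ≤ n := by exact_mod_cast (ZMod.val_lt (h i)).le
    gcongr
  rw [e1]
  refine (Finset.sum_le_sum fun h _ => e2 h).trans (le_of_eq ?_)
  rw [Finset.sum_const, Finset.card_univ]
  simp [ZMod.card]

theorem flipAt_flipAt {V : Type*} [DecidableEq V] (σ : V → Bool) (x : V) :
    flipAt (flipAt σ x) x = σ := by
  simp [flipAt]

/-- Upper bound in abstract form. -/
theorem upper_abs {V : Type*} [Fintype V] [DecidableEq V] [Nonempty V] (f : (V → Bool) → V → ℝ) :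
    EntPi (fun _ => 1 / (2 : ℝ) ^ (Fintype.card V)) (fun _ => 1 / (Fintype.card V : ℝ)) f ≤
      ∑ σ, 1 / (2 : ℝ) ^ (Fintype.card V) * (7 * (1 / (Fintype.card V : ℝ)) * (∑ x, ∑ y, (f σ x - f σ y) ^ 2)
        + 3 * ∑ z, (f (flipAt σ z) z - f σ z) ^ 2) := by
  have hN : (0 : ℝ) < Fintype.card V := by exact_mod_cast Fintype.card_pos
  have key := prod_lsi (β := V) (fun _ : V → Bool => 1 / (2 : ℝ) ^ (Fintype.card V))
      (fun _ => by positivity) _ lamp_lsi f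
  unfold EntPi
  refine key.trans ?_
  set M : ℝ := (2 : ℝ) ^ (Fintype.card V)
  set N : ℝ := (Fintype.card V : ℝ) with hNd
  have hM : 0 < M := by positivity
  have b1 : ∑ x, ∑ σ, ∑ z, (f (flipAt σ z) x - f σ x) ^ 2 ≤
      ∑ x, ∑ σ, ∑ z, 3 * ((f (flipAt σ z) x - f (flipAt σ z) z) ^ 2 +
        (f (flipAt σ z) z - f σ z) ^ 2 + (f σ x - f σ z) ^ 2) := by
    refine Finset.sum_le_sum fun x _ => Finset.sum_le_sum fun σ _ => Finset.sum_le_sum fun z _ => ?_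
    nlinarith [sq_nonneg ((f (flipAt σ z) x - f (flipAt σ z) z) - (f (flipAt σ z) z - f σ z)),
      sq_nonneg ((f (flipAt σ z) x - f (flipAt σ z) z) + (f σ x - f σ z)),
      sq_nonneg ((f (flipAt σ z) z - f σ z) + (f σ x - f σ z))]
  have c1 : ∀ x z, ∑ σ, (f (flipAt σ z) x - f (flipAt σ z) z) ^ 2 = ∑ σ, (f σ x - f σ z) ^ 2 := by
    intro x z
    exact Equiv.sum_comp (Function.Involutive.toPerm (fun σ : V → Bool => flipAt σ z)
      (fun σ => flipAt_flipAt σ z)) (fun σ => (f σ x - f σ z) ^ 2)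
  have c2 : ∑ x, ∑ σ, ∑ z, (f (flipAt σ z) x - f (flipAt σ z) z) ^ 2 =
      ∑ σ, ∑ x, ∑ z, (f σ x - f σ z) ^ 2 := by
    rw [Finset.sum_comm (f := fun σ x => ∑ z, (f σ x - f σ z) ^ 2)]
    refine Finset.sum_congr rfl fun x _ => ?_
    rw [Finset.sum_comm]
    simp only [c1]
    rw [Finset.sum_comm]
  have c3 : ∑ x, ∑ σ, ∑ z, (f σ x - f σ z) ^ 2 = ∑ σ, ∑ x, ∑ z, (f σ x - f σ z) ^ 2 :=
    Finset.sum_comm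
  have c4 : ∑ _x : V, ∑ σ, ∑ z, (f (flipAt σ z) z - f σ z) ^ 2 =
      N * ∑ σ, ∑ z, (f (flipAt σ z) z - f σ z) ^ 2 := by
    rw [Finset.sum_const, Finset.card_univ, nsmul_eq_mul]
  simp only [← Finset.mul_sum, Finset.sum_add_distrib] at b1 ⊢
  rw [c2, c3, c4] at b1
  set A := ∑ σ, ∑ x, ∑ z, (f σ x - f σ z) ^ 2
  set B := ∑ σ, ∑ z, (f (flipAt σ z) z - f σ z) ^ 2
  calc _ ≤ 1 / N * (1 / M * (3 * (A + N * B + A))) + 1 / M * (1 / N * A) := by gcongr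
    _ = _ := by field_simp; ring

theorem upper_torus (d n : ℕ) (hd : 1 ≤ d) (hn : 2 ≤ n) [NeZero n]
    (G : SimpleGraph (Fin d → ZMod n)) [DecidableRel G.Adj]
    (hG : ∀ x y : Fin d → ZMod n, G.Adj x y ↔
        ∃ i : Fin d, (y i = x i + 1 ∨ y i = x i - 1) ∧ ∀ j : Fin d, j ≠ i → y j = x j)
    (f : ((Fin d → ZMod n) → Bool) → (Fin d → ZMod n) → ℝ) :
    EntPi (fun _ => 1 / (2 : ℝ) ^ (n ^ d)) (fun _ => 1 / (n : ℝ) ^ d) f ≤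
      56 * (d : ℝ) ^ 2 * (n : ℝ) ^ (d + 2) *
      ((1 / 4) * ∑ σ : (Fin d → ZMod n) → Bool, ∑ x : Fin d → ZMod n, (1 / (2 : ℝ) ^ (n ^ d) * (1 / (n : ℝ) ^ d)) *
    ((∑ y ∈ G.neighborFinset x, 1 / (2 * (d : ℝ)) * (f σ y - f σ x) ^ 2)
      + 1 / 2 * (f (flipAt σ x) x - f σ x) ^ 2)) := by
  have hcard : Fintype.card (Fin d → ZMod n) = n ^ d := by simp [ZMod.card]
  have key := upper_abs f
  rw [hcard] at key
  push_cast at key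
  refine key.trans ?_
  have : Fact (1 < n) := ⟨by omega⟩
  have hn0 : (0 : ℝ) < n := by exact_mod_cast (by omega : 0 < n)
  have hn1 : (1 : ℝ) ≤ n := by exact_mod_cast (by omega : 1 ≤ n)
  have hd1 : (1 : ℝ) ≤ d := by exact_mod_cast hd
  rw [← mul_assoc, Finset.mul_sum]
  refine Finset.sum_le_sum fun σ _ => ?_
  have P := torus_poincare d n (f σ)
  have hnb : ∑ x, ∑ i, (f σ (x + Pi.single i 1) - f σ x) ^ 2 ≤
      ∑ x, ∑ y ∈ G.neighborFinset x, (f σ y - f σ x) ^ 2 := by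
    refine Finset.sum_le_sum fun x _ => ?_
    have hinj : Function.Injective (fun i : Fin d => x + Pi.single i (1 : ZMod n)) := by
      intro i j hij
      have h1 := congrFun (add_left_cancel hij) i
      by_contra hne
      simp [Pi.single_apply, hne] at h1
    have him := Finset.sum_image (s := Finset.univ) (g := fun i : Fin d => x + Pi.single i (1 : ZMod n))
      (f := fun y => (f σ y - f σ x) ^ 2) (fun i _ j _ h => hinj h)
    refine him.symm.le.trans ?_
    refine Finset.sum_le_sum_of_subset_of_nonneg ?_ fun _ _ _ => sq_nonneg _
    intro y hy
    obtain ⟨i, -, rfl⟩ := Finset.mem_image.1 hy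
    rw [SimpleGraph.mem_neighborFinset, hG]
    refine ⟨i, Or.inl (by simp), fun j hj => by simp [hj]⟩
  simp only [← Finset.mul_sum, Finset.sum_add_distrib]
  set A := ∑ x, ∑ y ∈ G.neighborFinset x, (f σ y - f σ x) ^ 2
  set B := ∑ x, (f (flipAt σ x) x - f σ x) ^ 2
  set D := ∑ x, ∑ y, (f σ x - f σ y) ^ 2
  have hB : 0 ≤ B := Finset.sum_nonneg fun _ _ => sq_nonneg _
  have hD : D ≤ (n : ℝ) ^ d * (d * (n : ℝ) ^ 2 * A) := P.trans (by gcongr)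
  calc _ ≤ 1 / (2 : ℝ) ^ (n ^ d) * (7 * (1 / (n : ℝ) ^ d) * ((n : ℝ) ^ d * (d * (n : ℝ) ^ 2 * A)) + 7 * (d : ℝ) ^ 2 * (n : ℝ) ^ 2 * B) := by
        gcongr
        have : (1 : ℝ) ≤ (d : ℝ) ^ 2 * (n : ℝ) ^ 2 :=
          one_le_mul_of_one_le_of_one_le (one_le_pow₀ hd1) (one_le_pow₀ hn1)
        nlinarith
    _ = _ := by
        rw [pow_add]
        field_simp
        ring

theorem ent_support_lower {α : Type*} [Fintype α] (m h : α → ℝ) (hm : ∀ a, 0 ≤ m a)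
    (hh : ∀ a, 0 ≤ h a) (S : Finset α) (hS : ∀ a, a ∉ S → h a = 0) (P : ℝ) (hP0 : 0 < P)
    (hP : ∑ a ∈ S, m a ≤ P) : (∑ a, m a * h a) * Real.log (1 / P) ≤ Ent m h := by
  classical
  unfold Ent
  set T := ∑ a, m a * h a with hT
  have hT0 : 0 ≤ T := Finset.sum_nonneg fun a _ => mul_nonneg (hm a) (hh a)
  rcases hT0.eq_or_lt with h0 | hpos
  · rw [← h0]; simp
  have hsum : ∑ a, (m a * h a - T / P * (if a ∈ S then m a else 0)) ≤
      ∑ a, (m a * h a * Real.log (h a / T) - m a * h a * Real.log (1 / P)) := by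
    refine Finset.sum_le_sum fun a _ => ?_
    rcases (hh a).eq_or_lt with ha | ha
    · rw [← ha]
      have : 0 ≤ T / P * (if a ∈ S then m a else 0) := by
        have := hm a
        split_ifs <;> positivity
      rw [mul_zero, zero_mul, zero_mul]; linarith
    · have haS : a ∈ S := by
        by_contra hc
        exact ha.ne' (hS a hc)
      rw [if_pos haS, ← mul_sub, ← Real.log_div (by positivity) (by positivity)]
      have := Real.one_sub_inv_le_log_of_pos (show 0 < h a / T / (1 / P) by positivity)
      have h2 := mul_le_mul_of_nonneg_left this (mul_nonneg (hm a) ha.le)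
      refine le_trans (le_of_eq ?_) h2
      field_simp
  rw [Finset.sum_sub_distrib, Finset.sum_sub_distrib, ← Finset.mul_sum, ← Finset.sum_mul, ← hT,
    Finset.sum_ite_mem, Finset.univ_inter] at hsum
  have : T / P * ∑ a ∈ S, m a ≤ T := by
    calc _ ≤ T / P * P := mul_le_mul_of_nonneg_left hP (by positivity)
      _ = T := by field_simp
  linarith

theorem lower_abs {V : Type*} [Fintype V] [DecidableEq V] [Nonempty V]
    (G : SimpleGraph V) [DecidableRel G.Adj] (p : V → V → ℝ) (φ : V → ℝ) :
    ∃ (f : (V → Bool) → V → ℝ) (w : ℝ), 0 < w ∧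
      w * (∑ x, φ x ^ 2) * (((Finset.univ.filter fun z => φ z = 0).card : ℝ) * Real.log 2) ≤
        EntPi (fun _ => 1 / (2 : ℝ) ^ (Fintype.card V)) (fun _ => 1 / (Fintype.card V : ℝ)) f ∧
      Epi G p (fun _ => 1 / (Fintype.card V : ℝ)) (fun _ => 1 / (2 : ℝ) ^ (Fintype.card V))
        (fun _ _ => 1 / 2) f = w * ((1 / 4) * ∑ x, ∑ y ∈ G.neighborFinset x, p x y * (φ y - φ x) ^ 2) := by
  classical
  have hN : (0 : ℝ) < Fintype.card V := by exact_mod_cast Fintype.card_pos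
  set Z := Finset.univ.filter fun z => φ z = 0 with hZ
  set S : Finset (V → Bool) := Fintype.piFinset (fun z => if φ z = 0 then {false} else Finset.univ) with hSdef
  have hmem : ∀ σ, σ ∈ S ↔ ∀ z, φ z = 0 → σ z = false := by
    intro σ
    rw [hSdef, Fintype.mem_piFinset]
    refine forall_congr' fun z => ?_
    by_cases h : φ z = 0 <;> simp [h]
  have hcard : S.card * 2 ^ Z.card = 2 ^ Fintype.card V := by
    rw [hSdef, Fintype.card_piFinset]
    have e1 : (2 : ℕ) ^ Z.card = ∏ z : V, if φ z = 0 then 2 else 1 := by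
      rw [Finset.prod_ite]; simp [hZ]
    have e2 : (2 : ℕ) ^ Fintype.card V = ∏ _z : V, 2 := by simp
    rw [e1, e2, ← Finset.prod_mul_distrib]
    refine Finset.prod_congr rfl fun z _ => ?_
    by_cases h : φ z = 0 <;> simp [h]
  have hcardR : (S.card : ℝ) * 2 ^ Z.card = 2 ^ Fintype.card V := by exact_mod_cast hcard
  have hSpos : (0 : ℝ) < S.card := by
    have : S.card ≠ 0 := by
      intro h; rw [h, zero_mul] at hcard
      exact absurd hcard.symm (by positivity)
    exact_mod_cast Nat.pos_of_ne_zero this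
  set M : ℝ := 2 ^ Fintype.card V with hM
  have hM0 : 0 < M := by positivity
  set N : ℝ := (Fintype.card V : ℝ)
  refine ⟨fun σ x => if σ ∈ S then φ x else 0, S.card / M * (1 / N), by positivity, ?_, ?_⟩
  · unfold EntPi
    have key := ent_support_lower (fun q : (V → Bool) × V => 1 / M * (1 / N))
      (fun q => (if q.1 ∈ S then φ q.2 else 0) ^ 2) (fun _ => by positivity) (fun _ => sq_nonneg _)
      (S ×ˢ Finset.univ) (by
        intro q hq
        have : q.1 ∉ S := by simpa using hq
        simp [this]) (S.card / M) (by positivity) (by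
        rw [Finset.sum_const, Finset.card_product, Finset.card_univ, nsmul_eq_mul]
        push_cast
        apply le_of_eq
        change (S.card : ℝ) * N * (1 / M * (1 / N)) = _
        field_simp)
    refine le_trans (le_of_eq ?_) key
    have hl : Real.log (1 / (S.card / M)) = Z.card * Real.log 2 := by
      rw [← Real.log_pow]
      congr 1
      rw [← hcardR]
      field_simp
    rw [hl]
    congr 1
    rw [Fintype.sum_prod_type]
    simp only [ite_pow, ne_eq, OfNat.ofNat_ne_zero, not_false_eq_true, zero_pow, mul_ite, mul_zero,
      ← Finset.mul_sum]
    have : ∀ σ : V → Bool, (∑ x, if σ ∈ S then 1 / M * (1 / N) * φ x ^ 2 else 0) =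
        if σ ∈ S then 1 / M * (1 / N) * ∑ x, φ x ^ 2 else 0 := by
      intro σ; split_ifs <;> simp [Finset.mul_sum]
    simp only [this]
    rw [Finset.sum_ite_mem, Finset.univ_inter, Finset.sum_const, nsmul_eq_mul]
    field_simp
  · unfold Epi
    have : ∀ σ : V → Bool, (∑ x, (1 / M * (1 / N)) *
        ((∑ y ∈ G.neighborFinset x, p x y * ((if σ ∈ S then φ y else 0) - (if σ ∈ S then φ x else 0)) ^ 2)
        + 1 / 2 * ((if flipAt σ x ∈ S then φ x else 0) - (if σ ∈ S then φ x else 0)) ^ 2)) =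
        if σ ∈ S then (1 / M * (1 / N)) * ∑ x, ∑ y ∈ G.neighborFinset x, p x y * (φ y - φ x) ^ 2 else 0 := by
      intro σ
      have hfl : ∀ x, ((if flipAt σ x ∈ S then φ x else 0) - (if σ ∈ S then φ x else 0)) = 0 := by
        intro x
        by_cases hx : φ x = 0
        · simp [hx]
        · have : flipAt σ x ∈ S ↔ σ ∈ S := by
            rw [hmem, hmem]
            refine forall_congr' fun z => ?_
            refine imp_congr_right fun hz => ?_
            have hne : z ≠ x := by rintro rfl; exact hx hz
            simp [flipAt, hne]
          simp [this]
      simp only [hfl]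
      by_cases hσ : σ ∈ S
      · simp [hσ, Finset.mul_sum]
      · simp [hσ]
    simp only [this]
    rw [Finset.sum_ite_mem, Finset.univ_inter, Finset.sum_const, nsmul_eq_mul]
    field_simp

theorem torus_sum (d n : ℕ) [NeZero n] (H : ZMod n → ℝ) (i : Fin d) :
    (n : ℝ) * ∑ x : Fin d → ZMod n, H (x i) = (n : ℝ) ^ d * ∑ k, H k := by
  have h1 : ∀ k : ZMod n, ∑ x : Fin d → ZMod n, H (x i) = ∑ x : Fin d → ZMod n, H (x i + k) := by
    intro k
    rw [← Equiv.sum_comp (Equiv.addRight (Pi.single i k : Fin d → ZMod n))]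
    simp
  have h2 : (n : ℝ) * ∑ x : Fin d → ZMod n, H (x i) = ∑ k : ZMod n, ∑ x : Fin d → ZMod n, H (x i + k) := by
    rw [← Finset.sum_congr rfl (fun k _ => h1 k), Finset.sum_const, Finset.card_univ, ZMod.card, nsmul_eq_mul]
  rw [h2, Finset.sum_comm]
  have h3 : ∀ x : Fin d → ZMod n, ∑ k, H (x i + k) = ∑ k, H k := fun x =>
    Equiv.sum_comp (Equiv.addLeft (x i)) H
  simp only [h3]
  rw [Finset.sum_const, Finset.card_univ, nsmul_eq_mul]
  simp [ZMod.card]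

theorem zmod_sum (n : ℕ) [NeZero n] (H : ℕ → ℝ) :
    ∑ k : ZMod n, H k.val = ∑ k ∈ Finset.range n, H k := by
  refine Finset.sum_bij (fun k _ => k.val) (fun k _ => Finset.mem_range.2 (ZMod.val_lt k))
    (fun a _ b _ h => ZMod.val_injective n h) (fun k hk => ⟨(k : ZMod n), Finset.mem_univ _, ?_⟩)
    (fun _ _ => rfl)
  exact ZMod.val_cast_of_lt (Finset.mem_range.1 hk)

noncomputable def bump (m k : ℕ) : ℝ := if k < m then (k : ℝ) * (m - k) else 0

theorem bump_step (m k : ℕ) : (bump m (k + 1) - bump m k) ^ 2 ≤ (m : ℝ) ^ 2 := by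
  have h0 : (0 : ℝ) ≤ k := by positivity
  apply sq_le_sq'
  all_goals
    unfold bump
    push_cast
    split_ifs with h1 h2 h2
    · have : (k : ℝ) + 1 < m := by exact_mod_cast h1
      nlinarith
    · omega
    · have : (k : ℝ) + 1 = m := by exact_mod_cast (by omega : k + 1 = m)
      rw [← this]; nlinarith
    · simp

theorem bump_sum_formula (m : ℕ) (M : ℝ) : 30 * ∑ k ∈ Finset.range m, ((k : ℝ) * (M - k)) ^ 2 =
    M ^ 2 * (5 * (m - 1) * m * (2 * m - 1)) - M * 15 * (m * (m - 1)) ^ 2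
      + (m - 1) * m * (2 * m - 1) * (3 * m ^ 2 - 3 * m - 1) := by
  induction m with
  | zero => simp
  | succ m ih => rw [Finset.sum_range_succ, mul_add, ih]; push_cast; ring

theorem bump_sum (m n : ℕ) (h2 : 2 ≤ m) (hmn : m ≤ n) :
    (m : ℝ) ^ 5 / 32 ≤ ∑ k ∈ Finset.range n, bump m k ^ 2 := by
  have h1 : ∑ k ∈ Finset.range m, bump m k ^ 2 ≤ ∑ k ∈ Finset.range n, bump m k ^ 2 :=
    Finset.sum_le_sum_of_subset_of_nonneg (Finset.range_mono hmn) fun _ _ _ => sq_nonneg _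
  have e : ∑ k ∈ Finset.range m, bump m k ^ 2 = ∑ k ∈ Finset.range m, ((k : ℝ) * (m - k)) ^ 2 := by
    refine Finset.sum_congr rfl fun k hk => ?_
    rw [bump, if_pos (Finset.mem_range.1 hk)]
  have f := bump_sum_formula m m
  have f2 : 30 * ∑ k ∈ Finset.range m, ((k : ℝ) * (m - k)) ^ 2 = (m : ℝ) * ((m : ℝ) ^ 4 - 1) := by
    rw [f]; ring
  have hm : (2 : ℝ) ≤ m := by exact_mod_cast h2
  have : (16 : ℝ) ≤ (m : ℝ) ^ 4 := by
    calc (16 : ℝ) = 2 ^ 4 := by norm_num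
      _ ≤ _ := by gcongr
  have h3 : (m : ℝ) * ((m : ℝ) ^ 4 - 1) ≥ m * (15 / 16 * (m : ℝ) ^ 4) := by
    gcongr; linarith
  have h4 : (m : ℝ) * (15 / 16 * (m : ℝ) ^ 4) = 30 * ((m : ℝ) ^ 5 / 32) := by ring
  linarith

theorem bump_val_succ (m n : ℕ) [NeZero n] (hn : 2 ≤ n) (hmn : m ≤ n) (k : ZMod n) :
    bump m (k + 1).val = bump m (k.val + 1) := by
  have : Fact (1 < n) := ⟨by omega⟩
  have hlt := ZMod.val_lt k
  rw [ZMod.val_add, ZMod.val_one]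
  rcases Nat.lt_or_ge (k.val + 1) n with h | h
  · rw [Nat.mod_eq_of_lt h]
  · have : k.val + 1 = n := by omega
    rw [this, Nat.mod_self]
    simp [bump, hmn]

theorem torus_degree (d n : ℕ) [NeZero n]
    (G : SimpleGraph (Fin d → ZMod n)) [DecidableRel G.Adj]
    (hG : ∀ x y : Fin d → ZMod n, G.Adj x y ↔
        ∃ i : Fin d, (y i = x i + 1 ∨ y i = x i - 1) ∧ ∀ j : Fin d, j ≠ i → y j = x j)
    (x : Fin d → ZMod n) : (G.neighborFinset x).card ≤ 2 * d := by
  have hsub : G.neighborFinset x ⊆ (Finset.univ : Finset (Fin d × Bool)).image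
      (fun q => Function.update x q.1 (if q.2 then x q.1 + 1 else x q.1 - 1)) := by
    intro y hy
    rw [SimpleGraph.mem_neighborFinset, hG] at hy
    obtain ⟨i, hi, hj⟩ := hy
    rw [Finset.mem_image]
    rcases hi with hi | hi
    · refine ⟨(i, true), Finset.mem_univ _, ?_⟩
      funext j
      by_cases h : j = i
      · subst h; simp [hi]
      · simp [h, hj j h]
    · refine ⟨(i, false), Finset.mem_univ _, ?_⟩
      funext j
      by_cases h : j = i
      · subst h; simp [hi]
      · simp [h, hj j h]
  refine (Finset.card_le_card hsub).trans (Finset.card_image_le.trans ?_)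
  simp [mul_comm]

theorem lower_torus (d n : ℕ) (hd : 1 ≤ d) (hn : 2 ≤ n) [NeZero n]
    (G : SimpleGraph (Fin d → ZMod n)) [DecidableRel G.Adj]
    (hG : ∀ x y : Fin d → ZMod n, G.Adj x y ↔
        ∃ i : Fin d, (y i = x i + 1 ∨ y i = x i - 1) ∧ ∀ j : Fin d, j ≠ i → y j = x j)
    (p : (Fin d → ZMod n) → (Fin d → ZMod n) → ℝ)
    (hp : ∀ x y, G.Adj x y → p x y = 1 / (2 * (d : ℝ))) (C : ℝ)
    (hC : ∀ f : ((Fin d → ZMod n) → Bool) → (Fin d → ZMod n) → ℝ,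
        EntPi (fun _ => 1 / (2 : ℝ) ^ (n ^ d)) (fun _ => 1 / (n : ℝ) ^ d) f ≤
        C * Epi G p (fun _ => 1 / (n : ℝ) ^ d) (fun _ => 1 / (2 : ℝ) ^ (n ^ d)) (fun _ _ => 1 / 2) f) :
    Real.log 2 / 128 * (n : ℝ) ^ (d + 2) ≤ C := by
  have hcard : Fintype.card (Fin d → ZMod n) = n ^ d := by simp [ZMod.card]
  have hn0 : (0 : ℝ) < n := by exact_mod_cast (by omega : 0 < n)
  have hd1 : (1 : ℝ) ≤ d := by exact_mod_cast hd
  have hlog : 0 < Real.log 2 := Real.log_pos (by norm_num)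
  obtain ⟨m, hm⟩ : ∃ m, m = n / 2 + 1 := ⟨_, rfl⟩
  have hm2 : 2 ≤ m := by omega
  have hmn : m ≤ n := by omega
  have hm2n : (n : ℝ) ≤ 2 * m := by exact_mod_cast (by omega : n ≤ 2 * m)
  have hm0 : (0 : ℝ) < m := by exact_mod_cast (by omega : 0 < m)
  let i0 : Fin d := ⟨0, hd⟩
  let φ : (Fin d → ZMod n) → ℝ := fun x => bump m (x i0).val
  obtain ⟨f, w, hw, hE, hD⟩ := lower_abs G p φ
  rw [hcard] at hE hD
  push_cast at hE hD
  have hf := hC f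
  -- sum of squares
  have hsq : (n : ℝ) ^ d * ((m : ℝ) ^ 2 * (n : ℝ) ^ 2) / 256 ≤ ∑ x, φ x ^ 2 := by
    have t := torus_sum d n (fun k => bump m k.val ^ 2) i0
    rw [zmod_sum n (fun k => bump m k ^ 2)] at t
    have b := bump_sum m n hm2 hmn
    have b2 : (n : ℝ) ^ 3 * (m : ℝ) ^ 2 / 256 ≤ (m : ℝ) ^ 5 / 32 := by
      have : (n : ℝ) ^ 3 ≤ (2 * m) ^ 3 := by gcongr
      have h2 : (n : ℝ) ^ 3 * (m : ℝ) ^ 2 ≤ (2 * m) ^ 3 * (m : ℝ) ^ 2 := by gcongr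
      have h3 : (2 * (m : ℝ)) ^ 3 * (m : ℝ) ^ 2 = 8 * (m : ℝ) ^ 5 := by ring
      linarith
    have h4 : (n : ℝ) ^ d * ((n : ℝ) ^ 3 * (m : ℝ) ^ 2 / 256) ≤ n * ∑ x, φ x ^ 2 := by
      refine le_trans ?_ t.symm.le
      exact mul_le_mul_of_nonneg_left (b2.trans b) (by positivity)
    refine le_of_mul_le_mul_left ?_ hn0
    refine le_trans (le_of_eq ?_) h4
    ring
  -- zero set
  have hz : (n : ℝ) ^ d / 2 ≤ ((Finset.univ.filter fun z => φ z = 0).card : ℝ) := by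
    have t := torus_sum d n (fun k => if bump m k.val = 0 then 1 else 0) i0
    rw [zmod_sum n (fun k => if bump m k = 0 then 1 else 0)] at t
    have e : ((Finset.univ.filter fun z => φ z = 0).card : ℝ) =
        ∑ x : Fin d → ZMod n, if bump m (x i0).val = 0 then 1 else 0 := by
      rw [Finset.sum_boole]
    have hc : (n : ℝ) / 2 ≤ ∑ k ∈ Finset.range n, if bump m k = 0 then (1 : ℝ) else 0 := by
      rw [Finset.sum_boole]
      have hsub : insert 0 (Finset.Ico m n) ⊆ (Finset.range n).filter (fun k => bump m k = 0) := by
        intro k hk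
        rw [Finset.mem_insert, Finset.mem_Ico] at hk
        rw [Finset.mem_filter, Finset.mem_range]
        rcases hk with rfl | hk
        · exact ⟨by omega, by simp [bump]⟩
        · exact ⟨hk.2, by simp [bump, hk.1]⟩
      have h1 := Finset.card_le_card hsub
      rw [Finset.card_insert_of_notMem (by simp; omega), Nat.card_Ico] at h1
      have h2 : n ≤ 2 * ((Finset.range n).filter (fun k => bump m k = 0)).card := by omega
      have h3 : (n : ℝ) ≤ 2 * ((Finset.range n).filter (fun k => bump m k = 0)).card := by
        exact_mod_cast h2
      linarith
    rw [e]
    refine le_of_mul_le_mul_left ?_ hn0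
    rw [t]
    calc _ = (n : ℝ) ^ d * (n / 2) := by ring
      _ ≤ _ := by gcongr
  -- Dirichlet form
  have hstep : ∀ k : ZMod n, (bump m (k + 1).val - bump m k.val) ^ 2 ≤ (m : ℝ) ^ 2 := by
    intro k
    rw [bump_val_succ m n hn hmn]
    exact bump_step m _
  have hDle : ∑ x, ∑ y ∈ G.neighborFinset x, p x y * (φ y - φ x) ^ 2 ≤ (n : ℝ) ^ d * (m : ℝ) ^ 2 := by
    have : ∀ x, ∑ y ∈ G.neighborFinset x, p x y * (φ y - φ x) ^ 2 ≤ (m : ℝ) ^ 2 := by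
      intro x
      have h1 : ∀ y ∈ G.neighborFinset x, p x y * (φ y - φ x) ^ 2 ≤ 1 / (2 * (d : ℝ)) * (m : ℝ) ^ 2 := by
        intro y hy
        rw [SimpleGraph.mem_neighborFinset] at hy
        rw [hp x y hy]
        refine mul_le_mul_of_nonneg_left ?_ (by positivity)
        obtain ⟨i, hi, hj⟩ := (hG x y).1 hy
        change (bump m (y i0).val - bump m (x i0).val) ^ 2 ≤ _
        by_cases h : i0 = i
        · rw [← h] at hi
          rcases hi with hi | hi
          · rw [hi]; exact hstep _
          · have : x i0 = y i0 + 1 := by rw [hi]; ring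
            rw [this, ← neg_sub, neg_sq]; exact hstep _
        · rw [hj i0 h]; simp
      refine (Finset.sum_le_sum h1).trans ?_
      rw [Finset.sum_const, nsmul_eq_mul]
      have hc : ((G.neighborFinset x).card : ℝ) ≤ 2 * d := by exact_mod_cast torus_degree d n G hG x
      calc _ ≤ (2 * (d : ℝ)) * (1 / (2 * (d : ℝ)) * (m : ℝ) ^ 2) := by gcongr
        _ = _ := by field_simp
    refine (Finset.sum_le_sum fun x _ => this x).trans (le_of_eq ?_)
    rw [Finset.sum_const, Finset.card_univ, hcard, nsmul_eq_mul]
    push_cast; ring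
  have hDnn : 0 ≤ ∑ x, ∑ y ∈ G.neighborFinset x, p x y * (φ y - φ x) ^ 2 := by
    refine Finset.sum_nonneg fun x _ => Finset.sum_nonneg fun y hy => ?_
    rw [SimpleGraph.mem_neighborFinset] at hy
    rw [hp x y hy]; positivity
  rw [hD] at hf
  set D := ∑ x, ∑ y ∈ G.neighborFinset x, p x y * (φ y - φ x) ^ 2
  set K := (n : ℝ) ^ d with hK
  have hK0 : 0 < K := by positivity
  have lo : w * (K * ((m : ℝ) ^ 2 * (n : ℝ) ^ 2) / 256) * (K / 2 * Real.log 2) ≤ C * (w * (1 / 4 * D)) := by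
    refine le_trans ?_ (hE.trans hf)
    gcongr
  have lo0 : 0 < w * (K * ((m : ℝ) ^ 2 * (n : ℝ) ^ 2) / 256) * (K / 2 * Real.log 2) := by positivity
  have hCpos : 0 < C := by
    by_contra hneg
    have : C * (w * (1 / 4 * D)) ≤ 0 := mul_nonpos_of_nonpos_of_nonneg (not_lt.1 hneg) (by positivity)
    linarith
  have hi : C * (w * (1 / 4 * D)) ≤ C * (w * (1 / 4 * (K * (m : ℝ) ^ 2))) := by gcongr
  have fin : (w * K * (m : ℝ) ^ 2 / 4) * (Real.log 2 / 128 * (n : ℝ) ^ (d + 2)) ≤ (w * K * (m : ℝ) ^ 2 / 4) * C := by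
    rw [pow_add, ← hK]
    refine le_trans (le_of_eq ?_) ((lo.trans hi).trans (le_of_eq ?_)) <;> ring
  exact le_of_mul_le_mul_left fin (by positivity)

/-- for the lamplighter on the `d`-dimensional discrete torus
`ℤ_n^d` (simple random walk `p(x,y) = 1/(2d)` for `y ∼ x`, `ν` uniform,
`μ` uniform on `{0,1}^{ℤ_n^d}`, `c_x(σ) = 1/2`), there exist constants
`c₀, C₀ > 0` depending only on `d` such that for all `n ≥ 2`,
`c₀ n^{d+2} ≤ C_LS(π) ≤ C₀ n^{d+2}`. -/
theorem torus_lamplighter_logSobolev (d : ℕ) (hd : 1 ≤ d) :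
    ∃ c₀ C₀ : ℝ, 0 < c₀ ∧ 0 < C₀ ∧
      ∀ (n : ℕ), 2 ≤ n → ∀ [NeZero n],
      ∀ (G : SimpleGraph (Fin d → ZMod n)) [DecidableRel G.Adj],
      (∀ x y : Fin d → ZMod n, G.Adj x y ↔
        ∃ i : Fin d, (y i = x i + 1 ∨ y i = x i - 1) ∧ ∀ j : Fin d, j ≠ i → y j = x j) →
      ∀ (p : (Fin d → ZMod n) → (Fin d → ZMod n) → ℝ),
      (∀ x y, G.Adj x y → p x y = 1 / (2 * (d : ℝ))) →
      (∀ x y, ¬ G.Adj x y → p x y = 0) →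
      ∀ (ν : (Fin d → ZMod n) → ℝ), (∀ x, ν x = 1 / (n : ℝ) ^ d) →
      ∀ (μ : ((Fin d → ZMod n) → Bool) → ℝ),
      (∀ σ, μ σ = 1 / 2 ^ (n ^ d)) →
      ∀ (c : (Fin d → ZMod n) → ((Fin d → ZMod n) → Bool) → ℝ),
      (∀ x σ, c x σ = 1 / 2) →
      ∀ (Clsπ : ℝ),
      IsLeast {C : ℝ | ∀ f : ((Fin d → ZMod n) → Bool) → (Fin d → ZMod n) → ℝ,
        EntPi μ ν f ≤ C * Epi G p ν μ c f} Clsπ →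
      c₀ * (n : ℝ) ^ (d + 2) ≤ Clsπ ∧ Clsπ ≤ C₀ * (n : ℝ) ^ (d + 2) := by
  refine ⟨Real.log 2 / 128, 56 * (d : ℝ) ^ 2, ?_, ?_, ?_⟩
  · have : 0 < Real.log 2 := Real.log_pos (by norm_num)
    positivity
  · have : (0 : ℝ) < d := by exact_mod_cast hd
    positivity
  intro n hn _ G _ hG p hp _ ν hν μ hμ c hc Cls hCls
  obtain rfl : ν = fun _ => 1 / (n : ℝ) ^ d := funext hν
  obtain rfl : μ = fun _ => 1 / (2 : ℝ) ^ (n ^ d) := funext hμ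
  obtain rfl : c = fun _ _ => 1 / 2 := funext fun x => funext fun σ => hc x σ
  refine ⟨lower_torus d n hd hn G hG p hp Cls hCls.1, hCls.2 fun f => ?_⟩
  refine (upper_torus d n hd hn G hG f).trans (le_of_eq ?_)
  unfold Epi
  congr 2
  refine Finset.sum_congr rfl fun σ _ => Finset.sum_congr rfl fun x _ => ?_
  congr 2
  refine Finset.sum_congr rfl fun y hy => ?_
  rw [hp x y ((SimpleGraph.mem_neighborFinset _ _ _).1 hy)]
end

section
/- Let V = {0,1} with its two vertices joined by an edge, p(0,1) = p(1,0) = 1/2, ν(0) = ν(1) = 1/2. Let p ∈ (0,1) with p ≠ 1/2, q = 1−p, let μ be the product on {0,1}^V of two Bernoulli measures giving mass p to 1 and q to 0, and let c_x(σ) = q if σ(x) = 1 and c_x(σ) = p if σ(x) = 0. Then the logarithmic Sobolev constant of the resulting lamplighter graph (on 8 vertices) satisfies (log p − log q)/(p − q) ≤ C_LS(π) ≤ 12·(log p − log q)/(p − q). -/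
open Finset

namespace LL
open Filter Topology

noncomputable def S (n : ℕ) (y : ℝ) : ℝ :=
  ∑ k ∈ range n, (1/2:ℝ)^(k+1) * (1 / (y ^ ((1/2:ℝ)^(k+1)) + 1))

theorem S_closed (y : ℝ) (hy : 0 < y) (hy1 : y ≠ 1) (n : ℕ) :
    S n y = 1 / (((1/2:ℝ)^n)⁻¹ * (y ^ ((1/2:ℝ)^n) - 1)) - 1 / (y - 1) := by
  induction n with
  | zero => simp [S]
  | succ n ih =>
    have e : S (n+1) y = S n y + (1/2:ℝ)^(n+1) * (1 / (y ^ ((1/2:ℝ)^(n+1)) + 1)) := by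
      simp [S, sum_range_succ]
    rw [e, ih]
    have hz : y ^ ((1/2:ℝ)^n) = (y ^ ((1/2:ℝ)^(n+1)))^2 := by
      rw [← Real.rpow_mul_natCast hy.le]
      congr 1
      push_cast; ring
    have hz0 : 0 < y ^ ((1/2:ℝ)^(n+1)) := Real.rpow_pos_of_pos hy _
    have hz1 : y ^ ((1/2:ℝ)^(n+1)) ≠ 1 := by
      intro h
      exact hy1 ((Real.rpow_left_inj hy.le zero_le_one
        (show ((1/2:ℝ)^(n+1)) ≠ 0 by positivity)).mp (h.trans (Real.one_rpow _).symm))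
    rw [hz]
    set z := y ^ ((1/2:ℝ)^(n+1))
    have h1 : z - 1 ≠ 0 := sub_ne_zero.mpr hz1
    have h2 : z + 1 ≠ 0 := by positivity
    have h3 : z^2 - 1 = (z-1)*(z+1) := by ring
    rw [h3, pow_succ]
    have h4 : ((1/2:ℝ)^n) ≠ 0 := by positivity
    have h5 : y - 1 ≠ 0 := sub_ne_zero.mpr hy1
    generalize (1/2:ℝ)^n = w at *
    field_simp
    ring

theorem S_tendsto (y : ℝ) (hy : 0 < y) (hy1 : y ≠ 1) :
    Tendsto (fun n => S n y) atTop (𝓝 (1 / Real.log y - 1 / (y - 1))) := by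
  have hd : HasDerivAt (fun h : ℝ => y ^ h) (Real.log y) 0 := by
    have := (Real.hasStrictDerivAt_const_rpow hy 0).hasDerivAt
    simpa using this
  have ht := hd.tendsto_slope_zero
  have hn : Tendsto (fun n : ℕ => (1/2:ℝ)^n) atTop (𝓝[≠] 0) := by
    rw [tendsto_nhdsWithin_iff]
    refine ⟨tendsto_pow_atTop_nhds_zero_of_lt_one (by norm_num) (by norm_num), ?_⟩
    exact Eventually.of_forall fun n => by simp
  have h2 := ht.comp hn
  have hl : Real.log y ≠ 0 := Real.log_ne_zero_of_pos_of_ne_one hy hy1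
  have h3 := ((tendsto_const_nhds (x := (1:ℝ))).div h2 hl).sub_const (1 / (y-1))
  refine h3.congr fun n => ?_
  rw [S_closed y hy hy1]
  simp

theorem S_one (n : ℕ) : S n 1 = (1 - (1/2:ℝ)^n) / 2 := by
  induction n with
  | zero => simp [S]
  | succ n ih =>
    have e : S (n+1) 1 = S n 1 + (1/2:ℝ)^(n+1) * (1 / ((1:ℝ) ^ ((1/2:ℝ)^(n+1)) + 1)) := by
      simp [S, sum_range_succ]
    rw [e, ih, Real.one_rpow]; ring

theorem rpow_tangent (s r a : ℝ) (hs : 0 < s) (hr : 0 < r) (ha : 0 ≤ a) (ha1 : a ≤ 1) :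
    s ^ a ≤ r ^ a + a * r ^ a / r * (s - r) := by
  have h := _root_.rpow_one_add_le_one_add_mul_self (s := s / r - 1)
    (by have := div_pos hs hr; linarith) ha ha1
  have e : (1 + (s / r - 1)) = s / r := by ring
  rw [e, Real.div_rpow hs.le hr.le] at h
  have hR : 0 < r ^ a := Real.rpow_pos_of_pos hr _
  rw [div_le_iff₀ hR] at h
  calc s ^ a ≤ _ := h
    _ = _ := by field_simp

theorem inv_tangent (z R : ℝ) (hz : 0 < z) (hR : 0 < R) :
    1 / (R + 1) - (z - R) / (R+1)^2 ≤ 1 / (z + 1) := by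
  have : 1 / (z + 1) - (1 / (R + 1) - (z - R) / (R+1)^2) = (z-R)^2 / ((z+1) * (R+1)^2) := by
    field_simp; ring
  have h2 : 0 ≤ (z-R)^2 / ((z+1) * (R+1)^2) := by positivity
  linarith

theorem term_tangent (s r a : ℝ) (hs : 0 < s) (hr : 0 < r) (ha : 0 ≤ a) (ha1 : a ≤ 1) :
    1 / (r ^ a + 1) - a * r ^ a / r * (s - r) / (r ^ a + 1) ^ 2 ≤ 1 / (s ^ a + 1) := by
  have h1 := rpow_tangent s r a hs hr ha ha1
  have hR : 0 < r ^ a := Real.rpow_pos_of_pos hr _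
  have h2 := inv_tangent (s ^ a) (r ^ a) (Real.rpow_pos_of_pos hs _) hR
  have h3 : (s ^ a - r ^ a) / (r^a+1)^2 ≤ (a * r ^ a / r * (s - r)) / (r ^ a + 1) ^ 2 := by
    gcongr; linarith
  linarith

theorem S_min (p q s1 s0 : ℝ) (hp : 0 < p) (hq : 0 < q) (hpq : p + q = 1) (h1 : 0 < s1)
    (h0 : 0 < s0) (hs : p * s1 + q * s0 = 1) (n : ℕ) :
    q * S n (q/p) + p * S n (p/q) ≤ q * S n s1 + p * S n s0 := by
  simp only [S, mul_sum, ← sum_add_distrib]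
  refine sum_le_sum fun k _ => ?_
  have hw : (0:ℝ) ≤ (1/2:ℝ)^(k+1) := by positivity
  have hw1 : (1/2:ℝ)^(k+1) ≤ 1 := pow_le_one₀ (by norm_num) (by norm_num)
  set a := (1/2:ℝ)^(k+1)
  have t1 := term_tangent s1 (q/p) a h1 (by positivity) hw hw1
  have t0 := term_tangent s0 (p/q) a h0 (by positivity) hw hw1
  have hR : 0 < (q/p) ^ a := Real.rpow_pos_of_pos (by positivity) _
  have hi : (p/q) ^ a = ((q/p) ^ a)⁻¹ := by
    rw [← Real.inv_rpow (by positivity), inv_div]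
  rw [hi] at t0 ⊢
  generalize (q/p) ^ a = R at *
  have key : q * (a * R / (q/p) * (s1 - q/p) / (R + 1)^2)
      + p * (a * R⁻¹ / (p/q) * (s0 - p/q) / (R⁻¹ + 1)^2) = 0 := by
    have e1 : q * (a * R / (q/p) * (s1 - q/p) / (R + 1)^2) = a * R / (R+1)^2 * (p * s1 - q) := by
      field_simp
    have e0 : p * (a * R⁻¹ / (p/q) * (s0 - p/q) / (R⁻¹ + 1)^2)
        = a * R / (R+1)^2 * (q * s0 - p) := by
      have : R⁻¹ + 1 = (R+1)/R := by field_simp; ring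
      rw [this]
      field_simp
    rw [e1, e0, ← mul_add]
    have : p * s1 - q + (q * s0 - p) = 0 := by linarith
    rw [this, mul_zero]
  have u1 := mul_le_mul_of_nonneg_left t1 hq.le
  have u0 := mul_le_mul_of_nonneg_left t0 hp.le
  have u := mul_le_mul_of_nonneg_left (add_le_add u1 u0) hw
  linear_combination u + a * key

/-- Abstract form: any lower limit works. -/
theorem log_ineq (p q s1 s0 L : ℝ) (hp : 0 < p) (hq : 0 < q) (hpq : p + q = 1) (h1 : 0 < s1)
    (h0 : 0 < s0) (hs : p * s1 + q * s0 = 1) (hne : s1 ≠ 1)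
    (hL : Tendsto (fun n => q * S n (q/p) + p * S n (p/q)) atTop (𝓝 L)) :
    L ≤ q / Real.log s1 + p / Real.log s0 := by
  have hne0 : s0 ≠ 1 := by
    intro h; subst h
    apply hne
    have : p * (s1 - 1) = 0 := by linarith
    rcases mul_eq_zero.mp this with h | h <;> linarith
  have t := ((S_tendsto s1 h1 hne).const_mul q).add ((S_tendsto s0 h0 hne0).const_mul p)
  have := le_of_tendsto_of_tendsto' hL t (S_min p q s1 s0 hp hq hpq h1 h0 hs)
  refine this.trans (le_of_eq ?_)
  have e1 : s1 - 1 ≠ 0 := sub_ne_zero.mpr hne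
  have e0 : s0 - 1 = - (p * (s1 - 1)) / q := by field_simp; linarith
  rw [e0]
  field_simp
  ring

theorem two_point_pos (p q a b K : ℝ) (hp : 0 < p) (hq : 0 < q) (hpq : p + q = 1) (hK : 0 < K)
    (hL : Tendsto (fun n => q * S n (q/p) + p * S n (p/q)) atTop (𝓝 (1/K)))
    (ha : a ≠ 0) (hb : b ≠ 0) :
    p * (a^2 * Real.log (a^2)) + q * (b^2 * Real.log (b^2))
      - (p * a^2 + q * b^2) * Real.log (p * a^2 + q * b^2) ≤ K * (p * q * (a - b)^2) := by
  have ha2 : 0 < a^2 := by positivity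
  have hb2 : 0 < b^2 := by positivity
  have hm : 0 < p * a^2 + q * b^2 := by positivity
  set m := p * a^2 + q * b^2 with hmdef
  have l1 : Real.log (a^2/m) = Real.log (a^2) - Real.log m := Real.log_div ha2.ne' hm.ne'
  have l0 : Real.log (b^2/m) = Real.log (b^2) - Real.log m := Real.log_div hb2.ne' hm.ne'
  have hs : p * (a^2/m) + q * (b^2/m) = 1 := by
    rw [hmdef]; field_simp
  have hs1 : 0 < a^2/m := by positivity
  have hs0 : 0 < b^2/m := by positivity
  have goal_eq : p * (a^2 * Real.log (a^2)) + q * (b^2 * Real.log (b^2)) - m * Real.log m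
      = p * Real.log (a^2/m) * a^2 + q * Real.log (b^2/m) * b^2 := by
    rw [l1, l0, hmdef]; ring
  rw [goal_eq]
  by_cases hne : a^2/m = 1
  · have : b^2/m = 1 := by
      rw [hne] at hs
      have : q * (b^2/m - 1) = 0 := by linarith
      rcases mul_eq_zero.mp this with h | h <;> linarith
    rw [hne, this]; simp; positivity
  have hineq := log_ineq p q _ _ (1/K) hp hq hpq hs1 hs0 hs hne hL
  generalize a^2/m = s1 at *
  generalize b^2/m = s0 at *
  have hprod : Real.log s1 * Real.log s0 < 0 := by
    rcases lt_or_gt_of_ne hne with h | h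
    · have : 1 < s0 := by
        by_contra hc
        have := mul_lt_mul_of_pos_left h hp
        have := mul_le_mul_of_nonneg_left (not_lt.mp hc) hq.le
        linarith
      exact mul_neg_of_neg_of_pos (Real.log_neg hs1 h) (Real.log_pos this)
    · have : s0 < 1 := by
        by_contra hc
        have := mul_lt_mul_of_pos_left h hp
        have := mul_le_mul_of_nonneg_left (not_lt.mp hc) hq.le
        linarith
      exact mul_neg_of_pos_of_neg (Real.log_pos h) (Real.log_neg hs0 this)
  generalize Real.log s1 = g1 at *
  generalize Real.log s0 = g0 at *
  have g1n : g1 ≠ 0 := by rintro rfl; simp at hprod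
  have g0n : g0 ≠ 0 := by rintro rfl; simp at hprod
  have e : q / g1 + p / g0 = (p * g1 + q * g0) / (g1 * g0) := by field_simp; ring
  rw [e] at hineq
  rw [le_div_iff_of_neg hprod] at hineq
  -- p g1 + q g0 ≤ g1 g0 / K
  have h6 : K * (p * g1 + q * g0) ≤ g1 * g0 := by
    have := mul_le_mul_of_nonneg_left hineq hK.le
    calc _ ≤ _ := this
      _ = _ := by field_simp
  have hT : p * g1 + q * g0 < 0 := by
    by_contra hc
    have := mul_nonneg hK.le (not_lt.mp hc)
    linarith
  have h7 : (p * g1 + q * g0) * (K * (p * q * (a - b)^2)) ≤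
      (p * g1 + q * g0) * (p * g1 * a^2 + q * g0 * b^2) := by
    have h8 : K * (p * g1 + q * g0) * (p * q * (a-b)^2) ≤ g1 * g0 * (p * q * (a-b)^2) := by
      gcongr
    nlinarith [sq_nonneg (p * g1 * a + q * g0 * b)]
  exact (mul_le_mul_left_of_neg hT).mp h7

theorem two_point (p q K : ℝ) (hp : 0 < p) (hq : 0 < q) (hpq : p + q = 1) (hK : 0 < K)
    (hL : Tendsto (fun n => q * S n (q/p) + p * S n (p/q)) atTop (𝓝 (1/K))) (a b : ℝ) :
    p * (a^2 * Real.log (a^2)) + q * (b^2 * Real.log (b^2))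
      - (p * a^2 + q * b^2) * Real.log (p * a^2 + q * b^2) ≤ K * (p * q * (a - b)^2) := by
  have hx : ∀ x : ℝ, ∀ᶠ t in 𝓝[≠] (0:ℝ), x + t ≠ 0 := by
    intro x
    by_cases h : x = 0
    · subst h
      filter_upwards [self_mem_nhdsWithin] with t ht
      simpa using ht
    · have : Tendsto (fun t => x + t) (𝓝[≠] (0:ℝ)) (𝓝 (x + 0)) :=
        ((continuous_const.add continuous_id).tendsto 0).mono_left nhdsWithin_le_nhds
      exact this.eventually_ne (by simpa using h)
  have hc : Continuous fun x : ℝ => x * Real.log x := Real.continuous_mul_log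
  have c1 : Continuous fun t : ℝ => p * ((a+t)^2 * Real.log ((a+t)^2))
      + q * ((b+t)^2 * Real.log ((b+t)^2))
      - (p * (a+t)^2 + q * (b+t)^2) * Real.log (p * (a+t)^2 + q * (b+t)^2) := by
    have h1 := hc.comp (f := fun t : ℝ => (a+t)^2) (by fun_prop)
    have h2 := hc.comp (f := fun t : ℝ => (b+t)^2) (by fun_prop)
    have h3 := hc.comp (f := fun t : ℝ => p * (a+t)^2 + q * (b+t)^2) (by fun_prop)
    exact ((h1.const_mul p).add (h2.const_mul q)).sub h3
  have c2 : Continuous fun t : ℝ => K * (p * q * ((a+t) - (b+t))^2) := by fun_prop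
  have t1 := (c1.tendsto 0).mono_left (nhdsWithin_le_nhds (s := {0}ᶜ))
  have t2 := (c2.tendsto 0).mono_left (nhdsWithin_le_nhds (s := {0}ᶜ))
  have := le_of_tendsto_of_tendsto t1 t2 (by
    filter_upwards [hx a, hx b] with t h1 h2
    exact two_point_pos p q _ _ K hp hq hpq hK hL h1 h2)
  simpa using this

theorem two_point_half (a b : ℝ) :
    (1/2) * (a^2 * Real.log (a^2)) + (1/2) * (b^2 * Real.log (b^2))
      - ((1/2) * a^2 + (1/2) * b^2) * Real.log ((1/2) * a^2 + (1/2) * b^2)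
      ≤ (1/2) * (a - b)^2 := by
  have := two_point (1/2) (1/2) 2 (by norm_num) (by norm_num) (by norm_num) (by norm_num) (by
    have h : Tendsto (fun n : ℕ => (1/2:ℝ)^n) atTop (𝓝 0) :=
      tendsto_pow_atTop_nhds_zero_of_lt_one (by norm_num) (by norm_num)
    have h2 := ((h.const_sub 1).div_const 2)
    rw [sub_zero] at h2
    refine h2.congr fun n => ?_
    rw [div_self (by norm_num), S_one]; ring) a b
  linarith

theorem two_point_ne (p q K : ℝ) (hp : 0 < p) (hq : 0 < q) (hpq : p + q = 1) (hne : p ≠ q)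
    (hKd : K = (Real.log p - Real.log q) / (p - q)) (hK : 0 < K) (a b : ℝ) :
    p * (a^2 * Real.log (a^2)) + q * (b^2 * Real.log (b^2))
      - (p * a^2 + q * b^2) * Real.log (p * a^2 + q * b^2) ≤ K * (p * q * (a - b)^2) := by
  refine two_point p q K hp hq hpq hK ?_ a b
  have n1 : q / p ≠ 1 := by rw [Ne, div_eq_one_iff_eq hp.ne']; exact hne.symm
  have n0 : p / q ≠ 1 := by rw [Ne, div_eq_one_iff_eq hq.ne']; exact hne
  have t := ((S_tendsto (q/p) (by positivity) n1).const_mul q).add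
    ((S_tendsto (p/q) (by positivity) n0).const_mul p)
  convert t using 2
  rw [Real.log_div hq.ne' hp.ne', Real.log_div hp.ne' hq.ne', hKd]
  have d1 : p - q ≠ 0 := sub_ne_zero.mpr hne
  have d2 : q - p ≠ 0 := sub_ne_zero.mpr hne.symm
  have d3 : Real.log p - Real.log q ≠ 0 := by
    intro h; rw [hKd, h] at hK; simp at hK
  have e1 : q / p - 1 = -(p - q)/p := by field_simp; ring
  have e0 : p / q - 1 = (p-q)/q := by field_simp
  have e2 : Real.log q - Real.log p = -(Real.log p - Real.log q) := by ring
  rw [e1, e0, e2]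
  generalize Real.log p - Real.log q = l at *
  field_simp
  ring

theorem K_ge (p q : ℝ) (hp : 0 < p) (hq : 0 < q) (hpq : p + q = 1) (hne : p ≠ q) :
    2 ≤ (Real.log p - Real.log q) / (p - q) := by
  have main : ∀ p q : ℝ, 0 < p → 0 < q → p + q = 1 → q < p →
      2 ≤ (Real.log p - Real.log q) / (p - q) := by
    intro p q hp hq hpq h
    rw [le_div_iff₀ (by linarith), ← Real.log_div hp.ne' hq.ne']
    have := Real.le_log_one_add_of_nonneg (x := p/q - 1) (by
      rw [sub_nonneg, one_le_div hq]; exact h.le)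
    have e : 1 + (p/q - 1) = p/q := by ring
    rw [e] at this
    refine le_trans (le_of_eq ?_) this
    have : p / q - 1 + 2 = 1 / q := by field_simp; linarith
    rw [this]
    field_simp
  rcases lt_or_gt_of_ne hne with h | h
  · have := main q p hq hp (by linarith) h
    rw [← neg_sub (Real.log p), ← neg_sub p q, neg_div_neg_eq] at this
    exact this
  · exact main p q hp hq hpq h

theorem minkowski (p q a b c d : ℝ) (hp : 0 ≤ p) (hq : 0 ≤ q) :
    (√(p * a^2 + q * b^2) - √(p * c^2 + q * d^2))^2 ≤ p * (a-c)^2 + q * (b-d)^2 := by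
  have h1 : 0 ≤ p * a^2 + q * b^2 := by positivity
  have h2 : 0 ≤ p * c^2 + q * d^2 := by positivity
  have h3 : p * a * c + q * b * d ≤ √(p * a^2 + q * b^2) * √(p * c^2 + q * d^2) := by
    rw [← Real.sqrt_mul h1]
    apply Real.le_sqrt_of_sq_le
    nlinarith [mul_nonneg (mul_nonneg hp hq) (sq_nonneg (a * d - b * c))]
  nlinarith [Real.sq_sqrt h1, Real.sq_sqrt h2]

/-- four-point product. -/
theorem four_point (p q K : ℝ) (hp : 0 < p) (hq : 0 < q) (hK : 0 < K)
    (H : ∀ a b : ℝ, p * (a^2 * Real.log (a^2)) + q * (b^2 * Real.log (b^2))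
      - (p * a^2 + q * b^2) * Real.log (p * a^2 + q * b^2) ≤ K * (p * q * (a - b)^2))
    (a b c d : ℝ) (m : ℝ) (hm : m = p * (p * a^2 + q * b^2) + q * (p * c^2 + q * d^2)) :
    p * p * (a^2 * Real.log (a^2)) + p * q * (b^2 * Real.log (b^2))
      + q * p * (c^2 * Real.log (c^2)) + q * q * (d^2 * Real.log (d^2)) - m * Real.log m
    ≤ K * (p * (p * q * (a-b)^2) + q * (p * q * (c-d)^2)
        + p * (p * q * (a-c)^2) + q * (p * q * (b-d)^2)) := by
  have h1 := mul_le_mul_of_nonneg_left (H a b) hp.le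
  have h2 := mul_le_mul_of_nonneg_left (H c d) hq.le
  have h3 := H (√(p * a^2 + q * b^2)) (√(p * c^2 + q * d^2))
  rw [Real.sq_sqrt (by positivity), Real.sq_sqrt (by positivity), ← hm] at h3
  have h4 := mul_le_mul_of_nonneg_left (minkowski p q a b c d hp.le hq.le)
    (mul_nonneg hK.le (mul_nonneg hp.le hq.le))
  linarith

/-- edge estimate -/
theorem edge (p q u1 u0 v1 v0 : ℝ) (hp : 0 < p) (hq : 0 < q) (hpq : p + q = 1) :
    p * q * (√((1/2) * u1^2 + (1/2) * v1^2) - √((1/2) * u0^2 + (1/2) * v0^2))^2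
    ≤ 3 * (p * q * (u1 - u0)^2) + 5/8 * (p * (u1 - v1)^2 + q * (u0 - v0)^2) := by
  have h := mul_le_mul_of_nonneg_left (minkowski (1/2) (1/2) u1 v1 u0 v0 (by norm_num)
    (by norm_num)) (mul_nonneg hp.le hq.le)
  refine h.trans ?_
  obtain rfl : q = 1 - p := by linarith
  have h2 := mul_nonneg (mul_nonneg hp.le hq.le)
    (sq_nonneg (4 * (u1 - u0) + ((u1 - v1) - (u0 - v0))))
  have h3 := sq_nonneg (p * (u1 - v1) + (1 - p) * (u0 - v0))
  linear_combination 1/8 * h2 + 5/8 * h3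

/-- eight-point inequality: `aij = f((i,j),x)`, `bij = f((i,j),y)`. -/
theorem eight (p q K : ℝ) (hp : 0 < p) (hq : 0 < q) (hpq : p + q = 1) (hne : p ≠ q)
    (hKd : K = (Real.log p - Real.log q) / (p - q))
    (a11 a10 a01 a00 b11 b10 b01 b00 m : ℝ)
    (hm : m = p*p*(1/2)*(a11^2 + b11^2) + p*q*(1/2)*(a10^2+b10^2) + q*p*(1/2)*(a01^2+b01^2)
      + q*q*(1/2)*(a00^2+b00^2)) :
    p*p*(1/2)*(a11^2 * Real.log (a11^2) + b11^2 * Real.log (b11^2))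
    + p*q*(1/2)*(a10^2 * Real.log (a10^2) + b10^2 * Real.log (b10^2))
    + q*p*(1/2)*(a01^2 * Real.log (a01^2) + b01^2 * Real.log (b01^2))
    + q*q*(1/2)*(a00^2 * Real.log (a00^2) + b00^2 * Real.log (b00^2)) - m * Real.log m
    ≤ 3 * K * ((1/2) * (p*p*(a11-b11)^2 + p*q*(a10-b10)^2 + q*p*(a01-b01)^2 + q*q*(a00-b00)^2)
      + p*q*(p*(a11-a01)^2 + q*(a10-a00)^2 + p*(b11-b10)^2 + q*(b01-b00)^2)) := by
  have hK2 : 2 ≤ K := hKd ▸ K_ge p q hp hq hpq hne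
  have hK : 0 < K := by linarith
  have N := fun a b : ℝ => Real.sq_sqrt (show 0 ≤ (1/2) * a^2 + (1/2) * b^2 by positivity)
  have h4 := four_point p q K hp hq hK (two_point_ne p q K hp hq hpq hne hKd hK)
    (√((1/2) * a11^2 + (1/2) * b11^2)) (√((1/2) * a10^2 + (1/2) * b10^2))
    (√((1/2) * a01^2 + (1/2) * b01^2)) (√((1/2) * a00^2 + (1/2) * b00^2)) m
    (by rw [N, N, N, N, hm]; ring)
  rw [N, N, N, N] at h4
  have i11 := mul_le_mul_of_nonneg_left (two_point_half a11 b11) (mul_nonneg hp.le hp.le)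
  have i10 := mul_le_mul_of_nonneg_left (two_point_half a10 b10) (mul_nonneg hp.le hq.le)
  have i01 := mul_le_mul_of_nonneg_left (two_point_half a01 b01) (mul_nonneg hq.le hp.le)
  have i00 := mul_le_mul_of_nonneg_left (two_point_half a00 b00) (mul_nonneg hq.le hq.le)
  have Kp := mul_nonneg hK.le hp.le
  have Kq := mul_nonneg hK.le hq.le
  have e1 := mul_le_mul_of_nonneg_left (edge p q a11 a01 b11 b01 hp hq hpq) Kp
  have e2 := mul_le_mul_of_nonneg_left (edge p q a10 a00 b10 b00 hp hq hpq) Kq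
  have e3 := mul_le_mul_of_nonneg_left (edge p q b11 b10 a11 a10 hp hq hpq) Kp
  have e4 := mul_le_mul_of_nonneg_left (edge p q b01 b00 a01 a00 hp hq hpq) Kq
  have c : ∀ a b : ℝ, √((1/2) * b^2 + (1/2) * a^2) = √((1/2) * a^2 + (1/2) * b^2) := by
    intro a b; rw [add_comm]
  rw [c a11 b11, c a10 b10] at e3
  rw [c a01 b01, c a00 b00] at e4
  have hA : 0 ≤ (K - 2) * (p*p*(a11-b11)^2 + p*q*(a10-b10)^2 + q*p*(a01-b01)^2 + q*q*(a00-b00)^2) := by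
    apply mul_nonneg <;> [linarith; positivity]
  linear_combination h4 + i11 + i10 + i01 + i00 + e1 + e2 + e3 + e4 + 1/4 * hA


theorem Ent_eq {α : Type*} [Fintype α] (m h : α → ℝ) (hm : ∀ a, 0 < m a) (hh : ∀ a, 0 ≤ h a) :
    Ent m h = ∑ a, m a * (h a * Real.log (h a))
      - (∑ a, m a * h a) * Real.log (∑ a, m a * h a) := by
  unfold Ent
  rw [sum_mul, ← sum_sub_distrib]
  refine sum_congr rfl fun a _ => ?_
  rcases (hh a).eq_or_lt with h0 | h0
  · simp [← h0]
  · have : 0 < ∑ b, m b * h b :=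
      sum_pos' (fun b _ => mul_nonneg (hm b).le (hh b)) ⟨a, mem_univ a, mul_pos (hm a) h0⟩
    rw [Real.log_div h0.ne' this.ne']
    ring

def st (i j : Bool) : Bool → Bool := fun b => if b then j else i

theorem sum_st (F : (Bool → Bool) → ℝ) :
    ∑ σ, F σ = F (st true true) + F (st true false) + F (st false true) + F (st false false) := by
  rw [← (Equiv.boolArrowEquivProd Bool).symm.sum_comp F, Fintype.sum_prod_type]
  simp only [Fintype.sum_bool]
  have : ∀ i j, (Equiv.boolArrowEquivProd Bool).symm (i, j) = st i j := fun i j => rfl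
  simp only [this]
  ring

theorem flip_false (i j : Bool) : flipAt (st i j) false = st (!i) j := by
  funext b; cases b <;> simp [flipAt, st, Function.update]

theorem flip_true (i j : Bool) : flipAt (st i j) true = st i (!j) := by
  funext b; cases b <;> simp [flipAt, st, Function.update]

theorem Epi_eq (G : SimpleGraph Bool) [DecidableRel G.Adj]
    (hAdj : ∀ x y : Bool, G.Adj x y ↔ x ≠ y)
    (p : Bool → Bool → ℝ) (hp : ∀ x y : Bool, x ≠ y → p x y = 1 / 2)
    (ν : Bool → ℝ) (hν : ∀ x, ν x = 1 / 2) (pr : ℝ)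
    (μ : (Bool → Bool) → ℝ)
    (hμ : ∀ σ : Bool → Bool, μ σ = ∏ x : Bool, (if σ x then pr else 1 - pr))
    (c : Bool → (Bool → Bool) → ℝ)
    (hc : ∀ (x : Bool) (σ : Bool → Bool), c x σ = if σ x then 1 - pr else pr)
    (f : (Bool → Bool) → Bool → ℝ) :
    Epi G p ν μ c f = (1/4) * ((1/2) * (pr * pr * (f (st true true) false - f (st true true) true)^2
      + pr * (1-pr) * (f (st true false) false - f (st true false) true)^2
      + (1-pr) * pr * (f (st false true) false - f (st false true) true)^2
      + (1-pr) * (1-pr) * (f (st false false) false - f (st false false) true)^2)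
      + pr * (1-pr) * (pr * (f (st true true) false - f (st false true) false)^2
        + (1-pr) * (f (st true false) false - f (st false false) false)^2
        + pr * (f (st true true) true - f (st true false) true)^2
        + (1-pr) * (f (st false true) true - f (st false false) true)^2)) := by
  have n1 : G.neighborFinset true = {false} := by
    ext y; rw [SimpleGraph.mem_neighborFinset, hAdj]; cases y <;> simp
  have n0 : G.neighborFinset false = {true} := by
    ext y; rw [SimpleGraph.mem_neighborFinset, hAdj]; cases y <;> simp
  unfold Epi
  rw [sum_st]
  simp only [Fintype.sum_bool, n1, n0, sum_singleton, flip_false, flip_true, hν,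
    hp true false (by simp), hp false true (by simp), hc, hμ, Fintype.prod_bool]
  simp [st]
  ring

theorem EntPi_eq (ν : Bool → ℝ) (hν : ∀ x, ν x = 1 / 2) (pr : ℝ) (hpr0 : 0 < pr) (hpr1 : pr < 1)
    (μ : (Bool → Bool) → ℝ)
    (hμ : ∀ σ : Bool → Bool, μ σ = ∏ x : Bool, (if σ x then pr else 1 - pr))
    (f : (Bool → Bool) → Bool → ℝ) (F : (Bool → Bool) → Bool → ℝ)
    (hF : ∀ σ x, F σ x = f σ x ^ 2 * Real.log (f σ x ^ 2)) (m : ℝ)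
    (hm : m = pr*pr*(1/2)*(f (st true true) false^2 + f (st true true) true^2)
      + pr*(1-pr)*(1/2)*(f (st true false) false^2 + f (st true false) true^2)
      + (1-pr)*pr*(1/2)*(f (st false true) false^2 + f (st false true) true^2)
      + (1-pr)*(1-pr)*(1/2)*(f (st false false) false^2 + f (st false false) true^2)) :
    EntPi μ ν f = pr*pr*(1/2)*(F (st true true) false + F (st true true) true)
      + pr*(1-pr)*(1/2)*(F (st true false) false + F (st true false) true)
      + (1-pr)*pr*(1/2)*(F (st false true) false + F (st false true) true)
      + (1-pr)*(1-pr)*(1/2)*(F (st false false) false + F (st false false) true)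
      - m * Real.log m := by
  have hq : 0 < 1 - pr := by linarith
  unfold EntPi
  rw [Ent_eq]
  rotate_left
  · rintro ⟨σ, x⟩
    simp only [hν, hμ]
    refine mul_pos (prod_pos fun y _ => ?_) (by norm_num)
    split_ifs <;> assumption
  · intro a; positivity
  have e : ∑ a : (Bool → Bool) × Bool, μ a.1 * ν a.2 * f a.1 a.2 ^ 2 = m := by
    rw [Fintype.sum_prod_type, sum_st, hm]
    simp only [Fintype.sum_bool, hν, hμ, Fintype.prod_bool]
    simp [st]
    ring
  rw [e]
  congr 1
  simp only [← hF]
  rw [Fintype.sum_prod_type, sum_st]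
  simp only [Fintype.sum_bool, hν, hμ, Fintype.prod_bool]
  simp [st]
  ring

end LL

/-- for the two-point base `V = {0,1}` with `p(0,1)=p(1,0)=1/2`,
`ν(0)=ν(1)=1/2`, `μ` the product of Bernoulli(`pr`) measures and flip rates
`c_x(σ) = q` if `σ(x)=1`, `c_x(σ) = pr` if `σ(x)=0` (`q = 1 - pr`,
`pr ∈ (0,1)`, `pr ≠ 1/2`), the log-Sobolev constant of the 8-point lamplighter
graph satisfies `(log pr - log q)/(pr - q) ≤ C_LS(π) ≤ 12 (log pr - log q)/(pr - q)`. -/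
theorem two_point_lamplighter_logSobolev
    (G : SimpleGraph Bool) [DecidableRel G.Adj]
    (hAdj : ∀ x y : Bool, G.Adj x y ↔ x ≠ y)
    (p : Bool → Bool → ℝ) (hp : ∀ x y : Bool, x ≠ y → p x y = 1 / 2)
    (ν : Bool → ℝ) (hν : ∀ x, ν x = 1 / 2)
    (pr : ℝ) (hpr0 : 0 < pr) (hpr1 : pr < 1) (hprne : pr ≠ 1 / 2)
    (μ : (Bool → Bool) → ℝ)
    (hμ : ∀ σ : Bool → Bool, μ σ = ∏ x : Bool, (if σ x then pr else 1 - pr))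
    (c : Bool → (Bool → Bool) → ℝ)
    (hc : ∀ (x : Bool) (σ : Bool → Bool), c x σ = if σ x then 1 - pr else pr)
    (Clsπ : ℝ)
    (hClsπ : IsLeast {C : ℝ | ∀ f : (Bool → Bool) → Bool → ℝ,
      EntPi μ ν f ≤ C * Epi G p ν μ c f} Clsπ) :
    (Real.log pr - Real.log (1 - pr)) / (pr - (1 - pr)) ≤ Clsπ ∧
      Clsπ ≤ 12 * ((Real.log pr - Real.log (1 - pr)) / (pr - (1 - pr))) := by
  have hq : 0 < 1 - pr := by linarith
  have hne : pr ≠ 1 - pr := fun h => hprne (by linarith)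
  have hK2 := LL.K_ge pr (1 - pr) hpr0 hq (by ring) hne
  set K := (Real.log pr - Real.log (1 - pr)) / (pr - (1 - pr)) with hK
  constructor
  · have h := hClsπ.1 (fun σ _ => if σ false then √((1 - pr) / pr) else √(pr / (1 - pr)))
    rw [LL.Epi_eq G hAdj p hp ν hν pr μ hμ c hc,
      LL.EntPi_eq ν hν pr hpr0 hpr1 μ hμ _ _ (fun _ _ => rfl) _ rfl] at h
    simp only [LL.st, Bool.false_eq_true, if_false, if_true] at h
    have s1 : √((1 - pr) / pr) ^ 2 = (1 - pr) / pr := Real.sq_sqrt (by positivity)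
    have s0 : √(pr / (1 - pr)) ^ 2 = pr / (1 - pr) := Real.sq_sqrt (by positivity)
    have s10 : √((1 - pr) / pr) * √(pr / (1 - pr)) = 1 := by
      rw [← Real.sqrt_mul (by positivity)]
      have : (1 - pr) / pr * (pr / (1 - pr)) = 1 := by field_simp
      rw [this, Real.sqrt_one]
    rw [s1, s0] at h
    have hd : (√((1 - pr) / pr) - √(pr / (1 - pr)))^2
        = (1 - pr) / pr + pr / (1 - pr) - 2 := by
      linear_combination s1 + s0 - 2 * s10
    rw [hd] at h
    have hM : pr*pr*(1/2)*((1 - pr) / pr + (1 - pr) / pr)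
        + pr*(1-pr)*(1/2)*((1 - pr) / pr + (1 - pr) / pr)
        + (1-pr)*pr*(1/2)*(pr / (1 - pr) + pr / (1 - pr))
        + (1-pr)*(1-pr)*(1/2)*(pr / (1 - pr) + pr / (1 - pr)) = 1 := by
      field_simp; ring
    rw [hM, Real.log_one, Real.log_div hq.ne' hpr0.ne', Real.log_div hpr0.ne' hq.ne'] at h
    have hd0 : pr - (1 - pr) ≠ 0 := sub_ne_zero.mpr hne
    have hl : Real.log pr - Real.log (1 - pr) = K * (pr - (1 - pr)) := by
      rw [hK]; field_simp
    have hl2 : Real.log (1 - pr) - Real.log pr = -(K * (pr - (1 - pr))) := by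
      rw [← hl]; ring
    rw [hl, hl2] at h
    have hpos : 0 < (pr - (1 - pr))^2 := by positivity
    have h2 : K * (pr - (1 - pr))^2 ≤ Clsπ * (1/4) * (pr - (1 - pr))^2 := by
      convert h using 1
      · field_simp; ring
      · field_simp; ring
    have h3 := le_of_mul_le_mul_right h2 hpos
    linarith
  · refine hClsπ.2 fun f => ?_
    rw [LL.Epi_eq G hAdj p hp ν hν pr μ hμ c hc,
      LL.EntPi_eq ν hν pr hpr0 hpr1 μ hμ f _ (fun _ _ => rfl) _ rfl]
    have h := LL.eight pr (1 - pr) K hpr0 hq (by ring) hne hK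
      (f (LL.st true true) false) (f (LL.st true false) false)
      (f (LL.st false true) false) (f (LL.st false false) false)
      (f (LL.st true true) true) (f (LL.st true false) true)
      (f (LL.st false true) true) (f (LL.st false false) true) _ rfl
    refine h.trans (le_of_eq ?_)
    ring
end
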